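/- arXiv:2410.04274 — 10 statements merged into one kernel-verified Lean document; each statement's English description precedes it below -/
import Mathlib

section
/- Let ψ : ℕ → ℂ be square-summable, i.e. ∑_{n=0}^∞ |ψ_n|² < ∞. Then for every z ∈ ℂ the series F(z) := ∑_{n=0}^∞ ψ_n z^n / √(n!) converges absolutely, and (1/π) ∫_ℂ e^{−|z|²} |F(z)|² dA(z) = ∑_{n=0}^∞ |ψ_n|², where dA denotes Lebesgue measure on ℂ ≅ ℝ². -/
open MeasureTheory

open Filter Topology ComplexConjugate

/-- The `n`-th Bargmann monomial `z ^ n / √n!`, weighted by the square root of the Gaussian density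
`(1/π) e^{-|z|²}`. -/
noncomputable def gaussianMonomial (n : ℕ) (z : ℂ) : ℂ :=
  ((Real.exp (-‖z‖ ^ 2 / 2) / Real.sqrt Real.pi : ℝ) : ℂ) *
    (z ^ n / (Real.sqrt (Nat.factorial n) : ℂ))

theorem continuous_gaussianMonomial (n : ℕ) : Continuous (gaussianMonomial n) := by
  unfold gaussianMonomial
  fun_prop

theorem exp_half_sq (x : ℝ) : Real.exp (x / 2) ^ 2 = Real.exp x := by
  rw [Real.exp_half, Real.sq_sqrt (Real.exp_pos x).le]

theorem norm_gaussianMonomial_sq (n : ℕ) (z : ℂ) :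
    ‖gaussianMonomial n z‖ ^ 2 =
      (Real.pi * n.factorial)⁻¹ * (‖z‖ ^ ((2 * n : ℕ) : ℝ) * Real.exp (-‖z‖ ^ (2 : ℝ))) := by
  rw [Real.rpow_natCast, Real.rpow_two, gaussianMonomial, norm_mul, norm_div, norm_pow,
    Complex.norm_real, Complex.norm_real, Real.norm_of_nonneg (by positivity),
    Real.norm_of_nonneg (by positivity), mul_pow, div_pow, div_pow, exp_half_sq,
    Real.sq_sqrt Real.pi_pos.le, Real.sq_sqrt (by positivity), ← pow_mul, mul_comm n 2]
  field_simp

theorem integral_norm_gaussianMonomial_sq (n : ℕ) :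
    ∫ z, ‖gaussianMonomial n z‖ ^ 2 = 1 := by
  simp_rw [norm_gaussianMonomial_sq]
  rw [integral_const_mul, Complex.integral_rpow_mul_exp_neg_rpow one_le_two
    ((by norm_num : (-2 : ℝ) < 0).trans_le (Nat.cast_nonneg _))]
  have : (((2 * n : ℕ) : ℝ) + 2) / 2 = n + 1 := by
    push_cast
    ring
  rw [this, Real.Gamma_nat_eq_factorial]
  have := Real.pi_ne_zero
  have := n.factorial_ne_zero
  field_simp

theorem memLp_gaussianMonomial (n : ℕ) : MemLp (gaussianMonomial n) 2 := by
  rw [memLp_two_iff_integrable_sq_norm (continuous_gaussianMonomial n).aestronglyMeasurable]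
  refine .of_integral_ne_zero ?_
  rw [integral_norm_gaussianMonomial_sq]
  exact one_ne_zero

theorem gaussianMonomial_circle_mul (n : ℕ) (c : Circle) (z : ℂ) :
    gaussianMonomial n (c * z) = (c : ℂ) ^ n * gaussianMonomial n z := by
  simp only [gaussianMonomial, norm_mul, Circle.norm_coe, one_mul, mul_pow]
  ring

theorem integral_inner_gaussianMonomial_of_ne {m n : ℕ} (h : m ≠ n) :
    ∫ z, inner ℂ (gaussianMonomial m z) (gaussianMonomial n z) = 0 := by
  have hne : (n : ℂ) - m ≠ 0 := sub_ne_zero.2 (Nat.cast_injective.ne h.symm)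
  set c := Circle.exp (Real.pi / (n - m)) with hc
  have hphase : (c : ℂ) ^ n * conj (c : ℂ) ^ m = -1 := by
    rw [hc, Circle.coe_exp, ← Complex.exp_conj, ← Complex.exp_nat_mul, ← Complex.exp_nat_mul,
      ← Complex.exp_add, ← Complex.exp_pi_mul_I]
    congr 1
    rw [map_mul, Complex.conj_ofReal, Complex.conj_I]
    push_cast
    field_simp
    ring
  have hrot := (rotation c).measurePreserving.integral_comp
    (rotation c).toHomeomorph.measurableEmbedding
    fun z => inner ℂ (gaussianMonomial m z) (gaussianMonomial n z)
  have hneg (z : ℂ) : inner ℂ (gaussianMonomial m (c * z)) (gaussianMonomial n (c * z)) =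
      -inner ℂ (gaussianMonomial m z) (gaussianMonomial n z) := by
    simp only [gaussianMonomial_circle_mul, RCLike.inner_apply, map_mul, map_pow]
    linear_combination
      gaussianMonomial n z * conj (gaussianMonomial m z) * hphase
  simp only [rotation_apply, hneg, integral_neg] at hrot
  exact self_eq_neg.1 hrot.symm

/-- The square-integrable class of `gaussianMonomial n`. -/
noncomputable def gaussianMonomialLp (n : ℕ) : Lp ℂ 2 (volume : Measure ℂ) :=
  (memLp_gaussianMonomial n).toLp

theorem MeasureTheory.L2.norm_sq_eq_integral_norm_sq {α : Type*} [MeasurableSpace α] {μ : Measure α}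
    (f : Lp ℂ 2 μ) : ‖f‖ ^ 2 = ∫ x, ‖f x‖ ^ 2 ∂μ := by
  have h := inner_self_eq_norm_sq_to_K (𝕜 := ℂ) f
  simp_rw [L2.inner_def, inner_self_eq_norm_sq_to_K] at h
  norm_cast at h
  exact h.symm

theorem orthonormal_gaussianMonomialLp : Orthonormal ℂ gaussianMonomialLp := by
  have hcoe (n : ℕ) : gaussianMonomialLp n =ᵐ[volume] gaussianMonomial n :=
    (memLp_gaussianMonomial n).coeFn_toLp
  refine ⟨fun n => ?_, fun m n h => ?_⟩
  · rw [← sq_eq_sq₀ (norm_nonneg _) zero_le_one, L2.norm_sq_eq_integral_norm_sq, one_pow,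
      ← integral_norm_gaussianMonomial_sq n]
    refine integral_congr_ae ?_
    filter_upwards [hcoe n] with z hz
    rw [hz]
  · change inner ℂ (gaussianMonomialLp m) (gaussianMonomialLp n) = 0
    rw [L2.inner_def, ← integral_inner_gaussianMonomial_of_ne h]
    refine integral_congr_ae ?_
    filter_upwards [hcoe m, hcoe n] with z hm hn
    rw [hm, hn]

theorem Orthonormal.summable_smul {ι E : Type*} [NormedAddCommGroup E] [InnerProductSpace ℂ E]
    [CompleteSpace E] {v : ι → E} (hv : Orthonormal ℂ v) {a : ι → ℂ}
    (ha : Summable fun i => ‖a i‖ ^ 2) : Summable fun i => a i • v i := by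
  simpa using (hv.orthogonalFamily.summable_iff_norm_sq_summable a).2 ha

theorem Orthonormal.norm_tsum_smul_sq {ι E : Type*} [NormedAddCommGroup E]
    [InnerProductSpace ℂ E] [CompleteSpace E] {v : ι → E} (hv : Orthonormal ℂ v) {a : ι → ℂ}
    (ha : Summable fun i => ‖a i‖ ^ 2) : ‖∑' i, a i • v i‖ ^ 2 = ∑' i, ‖a i‖ ^ 2 := by
  have hsum (s : Finset ι) : ‖∑ i ∈ s, a i • v i‖ ^ 2 = ∑ i ∈ s, ‖a i‖ ^ 2 := by
    simpa using hv.orthogonalFamily.norm_sum a s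
  have h := (hv.summable_smul ha).hasSum.norm.pow 2
  simp only [hsum] at h
  exact tendsto_nhds_unique h ha.hasSum

theorem MeasureTheory.Lp.ae_eq_of_hasSum_of_hasSum {α E : Type*} [MeasurableSpace α] {μ : Measure α}
    [NormedAddCommGroup E] {p : ENNReal} [Fact (1 ≤ p)] {f : ℕ → Lp E p μ} {g : Lp E p μ}
    {G : α → E} (hg : HasSum f g) (hG : ∀ᵐ x ∂μ, HasSum (fun n => f n x) (G x)) :
    g =ᵐ[μ] G := by
  obtain ⟨ns, hns, hlim⟩ :=
    (tendstoInMeasure_of_tendsto_Lp hg.tendsto_sum_nat).exists_seq_tendsto_ae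
  have hcoe : ∀ᵐ x ∂μ, ∀ n, (∑ i ∈ Finset.range n, f i : Lp E p μ) x =
      ∑ i ∈ Finset.range n, f i x := ae_all_iff.2 fun n => Lp.coeFn_fun_finsetSum _ _
  filter_upwards [hlim, hcoe, hG] with x hx hc hGx
  simp only [hc] at hx
  exact tendsto_nhds_unique hx (hGx.tendsto_sum_nat.comp hns.tendsto_atTop)

theorem summable_norm_stellar {ψ : ℕ → ℂ} (hψ : Summable fun n => ‖ψ n‖ ^ 2) (z : ℂ) :
    Summable fun n => ‖ψ n * z ^ n / (Real.sqrt (Nat.factorial n) : ℂ)‖ := by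
  refine .of_nonneg_of_le (fun _ => norm_nonneg _) (fun n => ?_)
    (hψ.add (Real.summable_pow_div_factorial (‖z‖ ^ 2)))
  have hsq : (‖z‖ ^ 2) ^ n / n.factorial = (‖z‖ ^ n / Real.sqrt n.factorial) ^ 2 := by
    rw [div_pow, Real.sq_sqrt (by positivity), ← pow_mul, ← pow_mul, mul_comm]
  rw [hsq, mul_div_assoc, norm_mul, norm_div, norm_pow, Complex.norm_real,
    Real.norm_of_nonneg (Real.sqrt_nonneg _)]
  nlinarith [sq_nonneg (‖ψ n‖ - ‖z‖ ^ n / Real.sqrt n.factorial), sq_nonneg ‖ψ n‖,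
    sq_nonneg (‖z‖ ^ n / Real.sqrt n.factorial)]



/-- The stellar (Bargmann) function of a square-summable sequence `ψ : ℕ → ℂ` is
`F(z) = ∑ ψ n * z ^ n / √(n!)`; it converges absolutely for every `z`, and its squared
`L²`-norm against the Gaussian measure `(1/π) e^{-|z|²} dA(z)` equals `∑ |ψ n|²`. -/
theorem stellar_function_isometry (ψ : ℕ → ℂ) (hψ : Summable fun n => ‖ψ n‖ ^ 2) :
    (∀ z : ℂ, Summable fun n => ‖ψ n * z ^ n / (Real.sqrt (Nat.factorial n) : ℂ)‖) ∧
    (1 / Real.pi) *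
        ∫ z : ℂ,
          Real.exp (-‖z‖ ^ 2) *
            ‖∑' n : ℕ, ψ n * z ^ n / (Real.sqrt (Nat.factorial n) : ℂ)‖ ^ 2 =
      ∑' n : ℕ, ‖ψ n‖ ^ 2 := by
  refine ⟨summable_norm_stellar hψ, ?_⟩
  have hv := orthonormal_gaussianMonomialLp
  have hpointwise : ∀ᵐ z : ℂ, HasSum (fun n => (ψ n • gaussianMonomialLp n) z)
      (((Real.exp (-‖z‖ ^ 2 / 2) / Real.sqrt Real.pi : ℝ) : ℂ) *
        ∑' n : ℕ, ψ n * z ^ n / (Real.sqrt (Nat.factorial n) : ℂ)) := by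
    have hcoe : ∀ᵐ z : ℂ, ∀ n, gaussianMonomialLp n z = gaussianMonomial n z :=
      ae_all_iff.2 fun n => (memLp_gaussianMonomial n).coeFn_toLp
    have hsmul : ∀ᵐ z : ℂ, ∀ n, (ψ n • gaussianMonomialLp n) z = ψ n • gaussianMonomialLp n z :=
      ae_all_iff.2 fun n => Lp.coeFn_smul _ _
    filter_upwards [hcoe, hsmul] with z hz hs
    convert! (summable_norm_stellar hψ z).of_norm.hasSum.mul_left _ using 2 with n
    rw [hs, hz, gaussianMonomial, smul_eq_mul]
    ring
  have hae := Lp.ae_eq_of_hasSum_of_hasSum (hv.summable_smul hψ).hasSum hpointwise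
  rw [← hv.norm_tsum_smul_sq hψ, L2.norm_sq_eq_integral_norm_sq, ← integral_const_mul]
  refine integral_congr_ae ?_
  filter_upwards [hae] with z hz
  rw [hz, norm_mul, mul_pow, Complex.norm_real, Real.norm_of_nonneg (by positivity), div_pow,
    exp_half_sq, Real.sq_sqrt Real.pi_pos.le]
  ring
end

section
/- Let A be an associative unital algebra over ℂ with distinguished elements X and P satisfying X·P − P·X = i·1. Then for all integers μ, ν ≥ 1, X^μ·P^ν − P^ν·X^μ = − ∑_{λ=1}^{min(μ,ν)} (−i)^λ · (μ!·ν!)/((μ−λ)!·(ν−λ)!·λ!) · X^{μ−λ}·P^{ν−λ}, where the coefficient μ!ν!/((μ−λ)!(ν−λ)!λ!) = λ!·C(μ,λ)·C(ν,λ) is a positive integer scalar multiplying via the ℂ-algebra structure. -/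
theorem mul_pow_eq_of_mul_eq_add {R A : Type*} [CommSemiring R] [Semiring A] [Algebra R A]
    {X P : A} {c : R} (h : P * X = X * P + algebraMap R A c) (m : ℕ) :
    P * X ^ m = X ^ m * P + (m * c) • X ^ (m - 1) := by
  induction m with
  | zero => simp
  | succ m ih =>
    have hX : ((m : R) * c) • (X ^ (m - 1) * X) = ((m : R) * c) • X ^ m := by
      rcases m with _ | m
      · simp
      · rw [Nat.add_sub_cancel, pow_succ]
    rw [pow_succ, ← mul_assoc, ih, add_mul, mul_assoc, h, mul_add, smul_mul_assoc, hX,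
      ← Algebra.commutes, ← Algebra.smul_def, Nat.add_sub_cancel, mul_assoc, add_assoc,
      ← add_smul]
    congr 2
    push_cast
    ring

/-- Reordering of `P ^ n * X ^ m` when `P * X = X * P + c` with `c` a scalar. -/
theorem pow_mul_pow_eq_sum_of_mul_eq_add {R A : Type*} [CommSemiring R] [Semiring A]
    [Algebra R A] {X P : A} {c : R} (h : P * X = X * P + algebraMap R A c) (m n : ℕ) :
    P ^ n * X ^ m = ∑ l ∈ Finset.range (n + 1),
      (c ^ l * ((m.descFactorial l * n.choose l : ℕ) : R)) • (X ^ (m - l) * P ^ (n - l)) := by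
  induction n with
  | zero => simp
  | succ n ih =>
    have hstep : ∀ l ∈ Finset.range (n + 1),
        P * ((c ^ l * ((m.descFactorial l * n.choose l : ℕ) : R)) •
            (X ^ (m - l) * P ^ (n - l))) =
          (c ^ l * ((m.descFactorial l * n.choose l : ℕ) : R)) •
              (X ^ (m - l) * P ^ (n + 1 - l)) +
            (c ^ (l + 1) * ((m.descFactorial (l + 1) * n.choose l : ℕ) : R)) •
              (X ^ (m - (l + 1)) * P ^ (n + 1 - (l + 1))) := by
      intro l hl
      have hl : l ≤ n := Nat.lt_succ_iff.mp (Finset.mem_range.mp hl)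
      rw [mul_smul_comm, ← mul_assoc, mul_pow_eq_of_mul_eq_add h, add_mul, mul_assoc,
        ← pow_succ', ← Nat.sub_add_comm hl, smul_add, smul_mul_assoc, smul_smul,
        Nat.sub_sub, Nat.add_sub_add_right, Nat.descFactorial_succ]
      congr 2
      push_cast
      ring
    rw [pow_succ', mul_assoc, ih, Finset.mul_sum, Finset.sum_congr rfl hstep,
      Finset.sum_add_distrib, Finset.sum_range_succ' _ (n + 1)]
    have hext := Finset.sum_range_succ (fun l =>
      (c ^ l * ((m.descFactorial l * n.choose l : ℕ) : R)) •
        (X ^ (m - l) * P ^ (n + 1 - l))) (n + 1)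
    simp only [Nat.choose_succ_self, mul_zero, Nat.cast_zero, zero_smul, add_zero] at hext
    rw [← hext, Finset.sum_range_succ', add_right_comm, ← Finset.sum_add_distrib]
    congr 1
    · refine Finset.sum_congr rfl fun l _ => ?_
      rw [← add_smul, Nat.choose_succ_succ]
      congr 1
      push_cast
      ring
    · simp

/-- Commutation relation between arbitrary powers of canonical operators `X`, `P` with
`[X, P] = i`:
`[X^μ, P^ν] = - ∑_{λ=1}^{min(μ,ν)} (-i)^λ (λ! C(μ,λ) C(ν,λ)) X^{μ-λ} P^{ν-λ}`,
where `λ! C(μ,λ) C(ν,λ) = μ!ν!/((μ-λ)!(ν-λ)!λ!)`. -/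
theorem powers_commutator (A : Type*) [Ring A] [Algebra ℂ A] (X P : A)
    (hXP : X * P - P * X = algebraMap ℂ A Complex.I)
    (μ ν : ℕ) (hμ : 1 ≤ μ) (hν : 1 ≤ ν) :
    X ^ μ * P ^ ν - P ^ ν * X ^ μ =
      - ∑ l ∈ Finset.Icc 1 (min μ ν),
          ((-Complex.I) ^ l *
              ((Nat.factorial l * Nat.choose μ l * Nat.choose ν l : ℕ) : ℂ)) •
            (X ^ (μ - l) * P ^ (ν - l)) := by
  have h : P * X = X * P + algebraMap ℂ A (-Complex.I) := by
    rw [map_neg, ← hXP]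
    abel
  have hsub : Finset.range (min μ ν + 1) ⊆ Finset.range (ν + 1) :=
    Finset.range_subset_range.mpr (by omega)
  rw [pow_mul_pow_eq_sum_of_mul_eq_add h, ← Finset.sum_subset hsub, Finset.sum_range_succ',
    ← Finset.Ico_add_one_right_eq_Icc, Finset.sum_Ico_eq_sum_range]
  · simp [Nat.descFactorial_eq_factorial_mul_choose, -Nat.descFactorial_succ, add_comm]
  · intro l hl hl'
    rw [Finset.mem_range] at hl hl'
    rw [Nat.descFactorial_of_lt (by omega)]
    simp
end

section
/- Let A be an associative unital algebra over ℂ with distinguished elements X and P satisfying X·P − P·X = i·1, and let α, β ∈ ℂ. Then for every natural number n, (α·X + β·P)^n = ∑_{k=0}^{⌊n/2⌋} ∑_{j=0}^{n−2k} (n!/(k!·j!·(n−2k−j)!)) · (−i/2)^k · α^{k+j} · β^{n−k−j} · X^j·P^{n−2k−j}. -/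
/-- The formal derivative of a power series over a semiring that need not be commutative. -/
noncomputable def PowerSeries.formalDeriv {R : Type*} [Semiring R] (f : PowerSeries R) :
    PowerSeries R :=
  PowerSeries.mk fun n => (n + 1) • PowerSeries.coeff (n + 1) f

theorem PowerSeries.coeff_formalDeriv {R : Type*} [Semiring R] (f : PowerSeries R) (n : ℕ) :
    PowerSeries.coeff n f.formalDeriv = (n + 1) • PowerSeries.coeff (n + 1) f :=
  PowerSeries.coeff_mk _ _

theorem PowerSeries.formalDeriv_mul {R : Type*} [Semiring R] (f g : PowerSeries R) :
    (f * g).formalDeriv = f.formalDeriv * g + f * g.formalDeriv := by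
  ext n
  have hsplit :
      (n + 1) • ∑ p ∈ Finset.HasAntidiagonal.antidiagonal (n + 1), coeff p.1 f * coeff p.2 g =
      ∑ p ∈ Finset.HasAntidiagonal.antidiagonal (n + 1), p.1 • (coeff p.1 f * coeff p.2 g) +
        ∑ p ∈ Finset.HasAntidiagonal.antidiagonal (n + 1), p.2 • (coeff p.1 f * coeff p.2 g) := by
    rw [Finset.smul_sum, ← Finset.sum_add_distrib]
    refine Finset.sum_congr rfl fun p hp => ?_
    rw [← Finset.HasAntidiagonal.mem_antidiagonal.mp hp, add_smul]
  rw [map_add, coeff_formalDeriv, coeff_mul, coeff_mul, coeff_mul, hsplit,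
    Finset.Nat.sum_antidiagonal_succ, Finset.Nat.sum_antidiagonal_succ']
  simp only [coeff_formalDeriv, zero_smul, zero_add, smul_mul_assoc, mul_smul_comm]

section DividedExponential

variable {A : Type*} [Ring A] [Algebra ℂ A]

/-- The exponential series `∑ n, aⁿ tⁿ / n!`. -/
noncomputable def expSeries (a : A) : PowerSeries A :=
  PowerSeries.mk fun n => (Nat.factorial n : ℂ)⁻¹ • a ^ n

theorem coeff_expSeries (a : A) (n : ℕ) :
    PowerSeries.coeff n (expSeries a) = (Nat.factorial n : ℂ)⁻¹ • a ^ n :=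
  PowerSeries.coeff_mk _ _

theorem succ_mul_inv_factorial_succ (n : ℕ) :
    ((n + 1 : ℕ) : ℂ) * (Nat.factorial (n + 1) : ℂ)⁻¹ = (Nat.factorial n : ℂ)⁻¹ := by
  have h : (n : ℂ) + 1 ≠ 0 := Nat.cast_add_one_ne_zero n
  rw [Nat.factorial_succ]
  push_cast
  field_simp

theorem formalDeriv_expSeries (a : A) :
    (expSeries a).formalDeriv = PowerSeries.C a * expSeries a := by
  ext n
  rw [PowerSeries.coeff_formalDeriv, PowerSeries.coeff_C_mul, coeff_expSeries, coeff_expSeries,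
    ← Nat.cast_smul_eq_nsmul ℂ, smul_smul, succ_mul_inv_factorial_succ, pow_succ', mul_smul_comm]

/-- The series `exp (d t²)` with scalar coefficients. -/
noncomputable def gaussianSeries (A : Type*) [Ring A] [Algebra ℂ A] (d : ℂ) : PowerSeries A :=
  PowerSeries.mk fun i =>
    algebraMap ℂ A (if Even i then d ^ (i / 2) / (Nat.factorial (i / 2) : ℂ) else 0)

theorem coeff_gaussianSeries (d : ℂ) (i : ℕ) :
    PowerSeries.coeff i (gaussianSeries A d) =
      algebraMap ℂ A (if Even i then d ^ (i / 2) / (Nat.factorial (i / 2) : ℂ) else 0) :=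
  PowerSeries.coeff_mk _ _

theorem gaussianSeries_mul_C (d : ℂ) (a : A) :
    gaussianSeries A d * PowerSeries.C a = PowerSeries.C a * gaussianSeries A d := by
  ext n
  rw [PowerSeries.coeff_C_mul, PowerSeries.coeff_mul_C, coeff_gaussianSeries, Algebra.commutes]

theorem formalDeriv_gaussianSeries (d : ℂ) :
    (gaussianSeries A d).formalDeriv =
      PowerSeries.C (algebraMap ℂ A (2 * d)) * (PowerSeries.X * gaussianSeries A d) := by
  ext n
  rw [PowerSeries.coeff_formalDeriv, PowerSeries.coeff_C_mul, coeff_gaussianSeries,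
    ← Nat.cast_smul_eq_nsmul ℂ, Algebra.smul_def, ← map_mul]
  cases n with
  | zero => simp
  | succ m =>
    rw [PowerSeries.coeff_succ_X_mul, coeff_gaussianSeries, ← map_mul]
    congr 1
    by_cases hm : Even m
    · obtain ⟨k, rfl⟩ := hm
      have h₁ : (k + k + 1 + 1) / 2 = k + 1 := by omega
      have h₂ : (k + k) / 2 = k := by omega
      have h₃ : Even (k + k + 1 + 1) := ⟨k + 1, by omega⟩
      have h₄ : (k : ℂ) + 1 ≠ 0 := Nat.cast_add_one_ne_zero k
      rw [if_pos h₃, if_pos ⟨k, rfl⟩, h₁, h₂, Nat.factorial_succ]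
      push_cast
      field_simp
      ring
    · have h : ¬ Even (m + 1 + 1) := by simpa [Nat.even_add_one] using hm
      rw [if_neg h, if_neg hm, mul_zero, mul_zero]

theorem mul_pow_succ_of_commutator {a b : A} {c : ℂ} (h : b * a = a * b + algebraMap ℂ A c)
    (n : ℕ) : b * a ^ (n + 1) = a ^ (n + 1) * b + (((n + 1 : ℕ) : ℂ) * c) • a ^ n := by
  induction n with
  | zero => simpa [Algebra.algebraMap_eq_smul_one] using h
  | succ n ih =>
    rw [pow_succ a (n + 1), ← mul_assoc, ih, add_mul, mul_assoc, h, mul_add, smul_mul_assoc,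
      ← pow_succ, ← Algebra.commutes, ← Algebra.smul_def, ← mul_assoc, add_assoc, ← add_smul]
    congr 2
    push_cast
    ring

theorem C_mul_expSeries_of_commutator {a b : A} {c : ℂ}
    (h : b * a = a * b + algebraMap ℂ A c) :
    PowerSeries.C b * expSeries a = expSeries a * PowerSeries.C b +
      PowerSeries.C (algebraMap ℂ A c) * (PowerSeries.X * expSeries a) := by
  ext n
  rw [map_add, PowerSeries.coeff_C_mul, PowerSeries.coeff_C_mul, PowerSeries.coeff_mul_C,
    coeff_expSeries]
  cases n with
  | zero => simp
  | succ n =>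
    rw [PowerSeries.coeff_succ_X_mul, coeff_expSeries, mul_smul_comm,
      mul_pow_succ_of_commutator h, smul_add, smul_mul_assoc, smul_smul, ← Algebra.smul_def,
      smul_smul, ← succ_mul_inv_factorial_succ n]
    congr 2
    ring

theorem formalDeriv_gaussianSeries_mul_expSeries_mul_expSeries {a b : A} {d : ℂ}
    (h : b * a = a * b + algebraMap ℂ A (2 * d)) :
    (gaussianSeries A d * (expSeries a * expSeries b)).formalDeriv =
      PowerSeries.C (a + b) * (gaussianSeries A d * (expSeries a * expSeries b)) := by
  rw [PowerSeries.formalDeriv_mul, PowerSeries.formalDeriv_mul, formalDeriv_expSeries,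
    formalDeriv_expSeries, formalDeriv_gaussianSeries, ← mul_assoc (expSeries a),
    eq_sub_of_add_eq (C_mul_expSeries_of_commutator h).symm, map_add]
  have hX := PowerSeries.X_mul (φ := gaussianSeries A d)
  have ha := gaussianSeries_mul_C d a
  have hb := gaussianSeries_mul_C d b
  have hc := gaussianSeries_mul_C d (algebraMap ℂ A (2 * d))
  generalize gaussianSeries A d = E at *
  generalize expSeries a = F
  generalize expSeries b = G
  simp only [sub_mul, mul_sub, mul_add, add_mul, ← mul_assoc, ha, hb, hc]
  rw [mul_assoc (PowerSeries.C (algebraMap ℂ A (2 * d))) E, ← hX]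
  simp only [← mul_assoc]
  abel

theorem coeff_eq_of_formalDeriv_eq_C_mul {f : PowerSeries A} {u : A}
    (h₀ : PowerSeries.coeff 0 f = 1) (h : f.formalDeriv = PowerSeries.C u * f) (n : ℕ) :
    (Nat.factorial n : ℂ) • PowerSeries.coeff n f = u ^ n := by
  induction n with
  | zero => simpa using h₀
  | succ n ih =>
    have hn := congrArg (PowerSeries.coeff n) h
    rw [PowerSeries.coeff_formalDeriv, PowerSeries.coeff_C_mul,
      ← Nat.cast_smul_eq_nsmul ℂ] at hn
    rw [Nat.factorial_succ, mul_comm, Nat.cast_mul, mul_smul, hn, ← mul_smul_comm, ih, pow_succ']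

theorem coeff_gaussianSeries_mul (d : ℂ) (f : PowerSeries A) (n : ℕ) :
    PowerSeries.coeff n (gaussianSeries A d * f) =
      ∑ k ∈ Finset.range (n / 2 + 1),
        (d ^ k / (Nat.factorial k : ℂ)) • PowerSeries.coeff (n - 2 * k) f := by
  rw [PowerSeries.coeff_mul, Finset.Nat.sum_antidiagonal_eq_sum_range_succ_mk]
  symm
  refine Finset.sum_of_injOn (fun k => 2 * k) (fun _ _ _ _ hk => by simpa using hk)
    (fun k hk => ?_) (fun i _ hi' => ?_) (fun k _ => ?_)
  · simp only [Finset.coe_range, Set.mem_Iio] at hk ⊢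
    omega
  · rw [coeff_gaussianSeries, if_neg, map_zero, zero_mul]
    rintro ⟨k, rfl⟩
    refine hi' ⟨k, ?_, by simp only; omega⟩
    simp only [Finset.coe_range, Set.mem_Iio, Finset.mem_range] at *
    omega
  · simp [coeff_gaussianSeries, Algebra.smul_def]

end DividedExponential


/-- Normal-form expansion of `(αX + βP)^n` for canonical operators with `[X, P] = i`:
`(αX + βP)^n = ∑_{k=0}^{⌊n/2⌋} ∑_{j=0}^{n-2k} (n!/(k! j! (n-2k-j)!)) (-i/2)^k α^{k+j} β^{n-k-j}
  X^j P^{n-2k-j}`. -/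
theorem binomial_normal_form (A : Type*) [Ring A] [Algebra ℂ A] (X P : A)
    (hXP : X * P - P * X = algebraMap ℂ A Complex.I) (α β : ℂ) (n : ℕ) :
    (α • X + β • P) ^ n =
      ∑ k ∈ Finset.range (n / 2 + 1), ∑ j ∈ Finset.range (n - 2 * k + 1),
        (((Nat.factorial n : ℂ) /
              ((Nat.factorial k : ℂ) * (Nat.factorial j : ℂ) *
                (Nat.factorial (n - 2 * k - j) : ℂ))) *
            (-Complex.I / 2) ^ k * α ^ (k + j) * β ^ (n - k - j)) •
          (X ^ j * P ^ (n - 2 * k - j)) := by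
  have h : (β • P) * (α • X) =
      (α • X) * (β • P) + algebraMap ℂ A (2 * (-Complex.I / 2 * α * β)) := by
    have hPX : P * X = X * P - algebraMap ℂ A Complex.I := by rw [← hXP]; abel
    rw [smul_mul_smul_comm, smul_mul_smul_comm, hPX, smul_sub, sub_eq_add_neg, mul_comm β α,
      Algebra.algebraMap_eq_smul_one, Algebra.algebraMap_eq_smul_one, smul_smul, ← neg_smul]
    congr 2
    ring
  rw [← coeff_eq_of_formalDeriv_eq_C_mul (by simp [PowerSeries.coeff_mul, coeff_expSeries,
    coeff_gaussianSeries]) (formalDeriv_gaussianSeries_mul_expSeries_mul_expSeries h),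
    coeff_gaussianSeries_mul, Finset.smul_sum]
  refine Finset.sum_congr rfl fun k hk => ?_
  rw [PowerSeries.coeff_mul, Finset.Nat.sum_antidiagonal_eq_sum_range_succ_mk, Finset.smul_sum,
    Finset.smul_sum]
  refine Finset.sum_congr rfl fun j hj => ?_
  have hexp : n - k - j = k + (n - 2 * k - j) := by
    simp only [Finset.mem_range] at hk hj
    omega
  simp only [coeff_expSeries, smul_pow, smul_smul, smul_mul_smul_comm]
  rw [hexp]
  congr 1
  simp only [mul_pow, pow_add, div_eq_mul_inv, mul_inv]
  ring
end

section
/- Let A be an associative unital algebra over ℂ with distinguished elements X and P satisfying X·P − P·X = i·1, and let α, β ∈ ℂ. Then for every natural number n, (α·X + β·P²)^n = n! · ∑_{(j,k,l,m) ∈ ℕ⁴, j+k+2l+3m=n} ((−i)^l · (−1)^m · α^{j+l+2m} · β^{k+l+m}) / (3^m · j! · k! · l! · m!) · X^j · P^{2k+l}. -/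
open Finset in
/-- Quadruples `(j, k, l, m)` with `j + k + 2l + 3m = n`. -/
def weightedQuadruples (n : ℕ) : Finset (ℕ × ℕ × ℕ × ℕ) :=
  {q ∈ range (n + 1) ×ˢ range (n + 1) ×ˢ range (n + 1) ×ˢ range (n + 1) |
    q.1 + q.2.1 + 2 * q.2.2.1 + 3 * q.2.2.2 = n}

lemma mem_weightedQuadruples {n : ℕ} {q : ℕ × ℕ × ℕ × ℕ} :
    q ∈ weightedQuadruples n ↔ q.1 + q.2.1 + 2 * q.2.2.1 + 3 * q.2.2.2 = n := by
  simp only [weightedQuadruples, Finset.mem_filter, Finset.mem_product, Finset.mem_range]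
  omega

/-- The coefficient of `X ^ j * P ^ (2 * k + l)` contributed by `(j, k, l, m)` to
`(αX + βP²)^n / n!`. -/
noncomputable def normalFormCoeff (α β : ℂ) (j k l m : ℕ) : ℂ :=
  ((-Complex.I) ^ l * (-1 : ℂ) ^ m * α ^ (j + l + 2 * m) * β ^ (k + l + m)) /
    ((3 : ℂ) ^ m * (Nat.factorial j : ℂ) * (Nat.factorial k : ℂ) *
      (Nat.factorial l : ℂ) * (Nat.factorial m : ℂ))

section normalFormCoeff

variable (α β : ℂ) (j k l m : ℕ)

lemma succ_mul_normalFormCoeff_fst :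
    ((j + 1 : ℕ) : ℂ) * normalFormCoeff α β (j + 1) k l m = α * normalFormCoeff α β j k l m := by
  have := Nat.cast_add_one_ne_zero (R := ℂ) j
  simp only [normalFormCoeff, Nat.factorial_succ]
  push_cast
  field_simp
  ring

lemma succ_mul_normalFormCoeff_snd :
    ((k + 1 : ℕ) : ℂ) * normalFormCoeff α β j (k + 1) l m = β * normalFormCoeff α β j k l m := by
  have := Nat.cast_add_one_ne_zero (R := ℂ) k
  simp only [normalFormCoeff, Nat.factorial_succ]
  push_cast
  field_simp
  ring

lemma succ_mul_normalFormCoeff_third :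
    ((l + 1 : ℕ) : ℂ) * normalFormCoeff α β j k (l + 1) m =
      -Complex.I * α * ((k + 1 : ℕ) : ℂ) * normalFormCoeff α β j (k + 1) l m := by
  have := Nat.cast_add_one_ne_zero (R := ℂ) l
  have := Nat.cast_add_one_ne_zero (R := ℂ) k
  simp only [normalFormCoeff, Nat.factorial_succ]
  push_cast
  field_simp
  ring

lemma succ_mul_normalFormCoeff_fourth :
    3 * ((m + 1 : ℕ) : ℂ) * normalFormCoeff α β j k l (m + 1) =
      -Complex.I * α * ((l + 1 : ℕ) : ℂ) * normalFormCoeff α β j k (l + 1) m := by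
  have := Nat.cast_add_one_ne_zero (R := ℂ) l
  have := Nat.cast_add_one_ne_zero (R := ℂ) m
  simp only [normalFormCoeff, Nat.factorial_succ]
  push_cast
  field_simp
  ring_nf
  simp only [Complex.I_sq]
  ring

end normalFormCoeff

section CanonicalCommutation

variable {A : Type*} [Ring A] [Algebra ℂ A] {X P : A}

lemma pow_mul_of_canonical_commutation
    (hXP : X * P - P * X = algebraMap ℂ A Complex.I) (N : ℕ) :
    P ^ N * X = X * P ^ N + (-Complex.I * N) • P ^ (N - 1) := by
  have hPX : P * X = X * P + (-Complex.I) • 1 := by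
    rw [neg_smul, ← Algebra.algebraMap_eq_smul_one, ← hXP]
    abel
  induction N with
  | zero => simp
  | succ N ih =>
    rw [pow_succ, mul_assoc, hPX, mul_add, ← mul_assoc, ih, add_mul, mul_assoc]
    cases N with
    | zero => simp
    | succ N =>
      simp only [smul_mul_assoc, Nat.add_sub_cancel, ← pow_succ, mul_smul_comm, mul_one]
      rw [add_assoc, ← add_smul]
      push_cast
      ring_nf

open Finset

variable (X P) in
/-- The sum of the normal-form terms of weight `n`, i.e. `(αX + βP²)^n / n!`. -/
noncomputable def normalFormSum (α β : ℂ) (n : ℕ) : A :=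
  ∑ q ∈ weightedQuadruples n, normalFormCoeff α β q.1 q.2.1 q.2.2.1 q.2.2.2 •
    (X ^ q.1 * P ^ (2 * q.2.1 + q.2.2.1))

lemma normalFormSum_mul (hXP : X * P - P * X = algebraMap ℂ A Complex.I) (α β : ℂ) (n : ℕ) :
    normalFormSum X P α β n * (α • X + β • P ^ 2) =
      ((n + 1 : ℕ) : ℂ) • normalFormSum X P α β (n + 1) := by
  let c (q : ℕ × ℕ × ℕ × ℕ) : ℂ := normalFormCoeff α β q.1 q.2.1 q.2.2.1 q.2.2.2
  let M (q : ℕ × ℕ × ℕ × ℕ) : A := X ^ q.1 * P ^ (2 * q.2.1 + q.2.2.1)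
  let D (q : ℕ × ℕ × ℕ × ℕ) : A := X ^ q.1 * P ^ (2 * q.2.1 + q.2.2.1 - 1)
  have h_fst : ∑ q ∈ weightedQuadruples n,
        (α * c q) • (X ^ (q.1 + 1) * P ^ (2 * q.2.1 + q.2.2.1)) =
      ∑ q ∈ weightedQuadruples (n + 1), ((q.1 : ℂ) * c q) • M q := by
    refine sum_bij_ne_zero (fun q _ _ => (q.1 + 1, q.2)) ?_ ?_ ?_ ?_
    · rintro ⟨j, k, l, m⟩ h -
      simp only [mem_weightedQuadruples] at h ⊢
      omega
    · rintro ⟨j, k, l, m⟩ - - ⟨j', k', l', m'⟩ - - h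
      simpa using h
    · rintro ⟨j | j, k, l, m⟩ h h0
      · simp at h0
      · refine ⟨(j, k, l, m), ?_, ?_, rfl⟩
        · simp only [mem_weightedQuadruples] at h ⊢
          omega
        · simpa only [c, M, succ_mul_normalFormCoeff_fst] using h0
    · rintro ⟨j, k, l, m⟩ - -
      simp only [c, M, succ_mul_normalFormCoeff_fst]
  have h_snd : ∑ q ∈ weightedQuadruples n,
        (β * c q) • (X ^ q.1 * P ^ (2 * (q.2.1 + 1) + q.2.2.1)) =
      ∑ q ∈ weightedQuadruples (n + 1), ((q.2.1 : ℂ) * c q) • M q := by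
    refine sum_bij_ne_zero (fun q _ _ => (q.1, q.2.1 + 1, q.2.2)) ?_ ?_ ?_ ?_
    · rintro ⟨j, k, l, m⟩ h -
      simp only [mem_weightedQuadruples] at h ⊢
      omega
    · rintro ⟨j, k, l, m⟩ - - ⟨j', k', l', m'⟩ - - h
      simpa using h
    · rintro ⟨j, k | k, l, m⟩ h h0
      · simp at h0
      · refine ⟨(j, k, l, m), ?_, ?_, rfl⟩
        · simp only [mem_weightedQuadruples] at h ⊢
          omega
        · simpa only [c, M, succ_mul_normalFormCoeff_snd] using h0
    · rintro ⟨j, k, l, m⟩ - -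
      simp only [c, M, succ_mul_normalFormCoeff_snd]
  have h_third : ∑ q ∈ weightedQuadruples n, (-Complex.I * α * q.2.1 * c q) • D q =
      ∑ q ∈ weightedQuadruples (n + 1), ((q.2.2.1 : ℂ) * c q) • M q := by
    have h_term (j k l m : ℕ) : (-Complex.I * α * ((k + 1 : ℕ) : ℂ) * c (j, k + 1, l, m)) •
        D (j, k + 1, l, m) = (((l + 1 : ℕ) : ℂ) * c (j, k, l + 1, m)) • M (j, k, l + 1, m) := by
      simp only [c, M, D, succ_mul_normalFormCoeff_third]
      congr 3
      omega
    refine sum_bij_ne_zero (fun q _ _ => (q.1, q.2.1 - 1, q.2.2.1 + 1, q.2.2.2)) ?_ ?_ ?_ ?_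
    · rintro ⟨j, _ | k, l, m⟩ h h0
      · simp at h0
      · simp only [mem_weightedQuadruples] at h ⊢
        omega
    · rintro ⟨j, _ | k, l, m⟩ - h0 ⟨j', _ | k', l', m'⟩ - h0' h
      · simp at h0
      · simp at h0
      · simp at h0'
      · simpa using h
    · rintro ⟨j, k, _ | l, m⟩ h h0
      · simp at h0
      · refine ⟨(j, k + 1, l, m), ?_, ?_, rfl⟩
        · simp only [mem_weightedQuadruples] at h ⊢
          omega
        · simpa only [h_term] using h0
    · rintro ⟨j, _ | k, l, m⟩ - h0
      · simp at h0
      · exact h_term j k l m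
  have h_fourth : ∑ q ∈ weightedQuadruples n, (-Complex.I * α * q.2.2.1 * c q) • D q =
      ∑ q ∈ weightedQuadruples (n + 1), (3 * (q.2.2.2 : ℂ) * c q) • M q := by
    have h_term (j k l m : ℕ) : (-Complex.I * α * ((l + 1 : ℕ) : ℂ) * c (j, k, l + 1, m)) •
        D (j, k, l + 1, m) =
          (3 * ((m + 1 : ℕ) : ℂ) * c (j, k, l, m + 1)) • M (j, k, l, m + 1) := by
      simp only [c, M, D, succ_mul_normalFormCoeff_fourth]
      congr 3
    refine sum_bij_ne_zero (fun q _ _ => (q.1, q.2.1, q.2.2.1 - 1, q.2.2.2 + 1)) ?_ ?_ ?_ ?_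
    · rintro ⟨j, k, _ | l, m⟩ h h0
      · simp at h0
      · simp only [mem_weightedQuadruples] at h ⊢
        omega
    · rintro ⟨j, k, _ | l, m⟩ - h0 ⟨j', k', _ | l', m'⟩ - h0' h
      · simp at h0
      · simp at h0
      · simp at h0'
      · simpa using h
    · rintro ⟨j, k, l, _ | m⟩ h h0
      · simp at h0
      · refine ⟨(j, k, l + 1, m), ?_, ?_, rfl⟩
        · simp only [mem_weightedQuadruples] at h ⊢
          omega
        · simpa only [h_term] using h0
    · rintro ⟨j, k, _ | l, m⟩ - h0
      · simp at h0
      · exact h_term j k l m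
  have h_weight : ((n + 1 : ℕ) : ℂ) • normalFormSum X P α β (n + 1) =
      ∑ q ∈ weightedQuadruples (n + 1), ((q.1 : ℂ) * c q) • M q +
      ∑ q ∈ weightedQuadruples (n + 1), ((q.2.1 : ℂ) * c q) • M q +
      (2 : ℂ) • ∑ q ∈ weightedQuadruples (n + 1), ((q.2.2.1 : ℂ) * c q) • M q +
      ∑ q ∈ weightedQuadruples (n + 1), (3 * (q.2.2.2 : ℂ) * c q) • M q := by
    simp only [normalFormSum, smul_sum, ← sum_add_distrib]
    refine sum_congr rfl fun q hq => ?_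
    rw [← mem_weightedQuadruples.mp hq]
    simp only [smul_smul, ← add_smul]
    congr 1
    push_cast
    ring
  rw [h_weight, ← h_fst, ← h_snd, ← h_third, ← h_fourth, normalFormSum, sum_mul]
  simp only [smul_sum, ← sum_add_distrib]
  refine sum_congr rfl fun q _ => ?_
  have h_X : X ^ q.1 * P ^ (2 * q.2.1 + q.2.2.1) * X =
      X ^ (q.1 + 1) * P ^ (2 * q.2.1 + q.2.2.1) +
        (-Complex.I * ((2 * q.2.1 + q.2.2.1 : ℕ) : ℂ)) • D q := by
    rw [mul_assoc, pow_mul_of_canonical_commutation hXP, mul_add, ← mul_assoc, ← pow_succ,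
      mul_smul_comm]
  have h_P : X ^ q.1 * P ^ (2 * q.2.1 + q.2.2.1) * P ^ 2 =
      X ^ q.1 * P ^ (2 * (q.2.1 + 1) + q.2.2.1) := by
    rw [mul_assoc, ← pow_add]
    congr 2
    ring
  simp only [mul_add, mul_smul_comm, smul_mul_assoc, h_X, h_P]
  push_cast
  module

lemma pow_eq_factorial_smul_normalFormSum
    (hXP : X * P - P * X = algebraMap ℂ A Complex.I) (α β : ℂ) (n : ℕ) :
    (α • X + β • P ^ 2) ^ n = (Nat.factorial n : ℂ) • normalFormSum X P α β n := by
  induction n with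
  | zero =>
    have : weightedQuadruples 0 = {(0, 0, 0, 0)} := rfl
    simp [normalFormSum, normalFormCoeff, this]
  | succ n ih =>
    rw [pow_succ, ih, smul_mul_assoc, normalFormSum_mul hXP, smul_smul, Nat.factorial_succ,
      Nat.cast_mul, mul_comm]

end CanonicalCommutation


/-- Normal-form expansion of `(αX + βP²)^n` for canonical operators with `[X, P] = i`:
`(αX + βP²)^n = n! ∑_{j+k+2l+3m=n} ((-i)^l (-1)^m α^{j+l+2m} β^{k+l+m})/(3^m j! k! l! m!)
  X^j P^{2k+l}`. -/
theorem cubic_binomial_normal_form (A : Type*) [Ring A] [Algebra ℂ A] (X P : A)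
    (hXP : X * P - P * X = algebraMap ℂ A Complex.I) (α β : ℂ) (n : ℕ) :
    (α • X + β • P ^ 2) ^ n =
      (Nat.factorial n : ℂ) •
        ∑ j ∈ Finset.range (n + 1), ∑ k ∈ Finset.range (n + 1),
          ∑ l ∈ Finset.range (n + 1), ∑ m ∈ Finset.range (n + 1),
            if j + k + 2 * l + 3 * m = n then
              (((-Complex.I) ^ l * (-1 : ℂ) ^ m * α ^ (j + l + 2 * m) * β ^ (k + l + m)) /
                  ((3 : ℂ) ^ m * (Nat.factorial j : ℂ) * (Nat.factorial k : ℂ) *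
                    (Nat.factorial l : ℂ) * (Nat.factorial m : ℂ))) •
                (X ^ j * P ^ (2 * k + l))
            else 0 := by
  rw [pow_eq_factorial_smul_normalFormSum hXP, normalFormSum, weightedQuadruples,
    Finset.sum_filter]
  simp only [Finset.sum_product, normalFormCoeff]
end

section
/- Let R be a (possibly noncommutative) unital ring and X, Y ∈ R. Define the binomial operators B_n(X,Y) := ∑_{k=0}^n C(n,k)·X^k·Y^{n−k}. Then for every natural number n, (X+Y)^n = B_n(X,Y) + ∑_{k=0}^{n−2} (X+Y)^k · (Y·B_{n−1−k}(X,Y) − B_{n−1−k}(X,Y)·Y). -/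
/-- The `n`-th binomial operator `B_n(X,Y) = ∑_{k=0}^n C(n,k) X^k Y^{n-k}` for possibly
noncommuting elements of a ring. -/
def binomialOp {R : Type*} [Ring R] (X Y : R) (n : ℕ) : R :=
  ∑ k ∈ Finset.range (n + 1), Nat.choose n k • (X ^ k * Y ^ (n - k))

theorem binomialOp_eq_sum_antidiagonal {R : Type*} [Ring R] (X Y : R) (n : ℕ) :
    binomialOp X Y n =
      ∑ p ∈ Finset.HasAntidiagonal.antidiagonal n, Nat.choose n p.1 • (X ^ p.1 * Y ^ p.2) := by
  rw [Finset.Nat.sum_antidiagonal_eq_sum_range_succ_mk, binomialOp]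

theorem binomialOp_zero {R : Type*} [Ring R] (X Y : R) : binomialOp X Y 0 = 1 := by
  simp [binomialOp]

theorem binomialOp_succ {R : Type*} [Ring R] (X Y : R) (n : ℕ) :
    binomialOp X Y (n + 1) = X * binomialOp X Y n + binomialOp X Y n * Y := by
  simp only [binomialOp_eq_sum_antidiagonal]
  rw [Finset.sum_antidiagonal_choose_succ_nsmul (fun i j => X ^ i * Y ^ j), add_comm,
    Finset.mul_sum, Finset.sum_mul]
  congr 1 <;> refine Finset.sum_congr rfl fun p hp => ?_
  · rw [← Nat.choose_symm_of_eq_add (Finset.HasAntidiagonal.mem_antidiagonal.mp hp).symm, mul_smul_comm,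
      pow_succ', mul_assoc]
  · rw [smul_mul_assoc, pow_succ, mul_assoc]

theorem add_mul_binomialOp {R : Type*} [Ring R] (X Y : R) (n : ℕ) :
    (X + Y) * binomialOp X Y n =
      binomialOp X Y (n + 1) + (Y * binomialOp X Y n - binomialOp X Y n * Y) := by
  rw [binomialOp_succ]
  noncomm_ring

/-- Wyss' noncommutative binomial theorem:
`(X+Y)^n = B_n(X,Y) + ∑_{k=0}^{n-2} (X+Y)^k [Y, B_{n-1-k}(X,Y)]`. -/
theorem noncomm_binomial (R : Type*) [Ring R] (X Y : R) (n : ℕ) :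
    (X + Y) ^ n =
      binomialOp X Y n +
        ∑ k ∈ Finset.range (n - 1),
          (X + Y) ^ k *
            (Y * binomialOp X Y (n - 1 - k) - binomialOp X Y (n - 1 - k) * Y) := by
  rcases n with _ | n
  · simp [binomialOp_zero]
  induction n with
  | zero => simp [binomialOp_succ, binomialOp_zero]
  | succ n ih =>
    simp only [Nat.add_sub_cancel] at ih ⊢
    rw [pow_succ', ih, mul_add, add_mul_binomialOp, Finset.sum_range_succ', Finset.mul_sum,
      pow_zero, one_mul, Nat.sub_zero, add_assoc, add_comm (∑ k ∈ Finset.range n, _)]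
    congr 2
    refine Finset.sum_congr rfl fun k _ => ?_
    rw [pow_succ', mul_assoc, Nat.add_sub_add_right]
end

section
/- Let A be an associative unital algebra over ℂ with distinguished elements X and P satisfying X·P − P·X = i·1. Then for all integers s, r ≥ 1 there exist nonnegative real numbers α_{m,n}, for 0 ≤ m ≤ s−1 and 0 ≤ n ≤ r−1, such that X^s·P^r − P^r·X^s = i · ∑_{m=0}^{s−1} ∑_{n=0}^{r−1} α_{m,n} · (X^m·P^n + P^n·X^m). -/
open PowerSeries in
/-- The power series of `tan (z / 2)`, written as `-i (e^{iz} - 1) / (e^{iz} + 1)`. -/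
noncomputable def tanHalf : PowerSeries ℂ :=
  C (-Complex.I) * (rescale Complex.I (exp ℂ) - 1) * (rescale Complex.I (exp ℂ) + 1)⁻¹

namespace tanHalf

open PowerSeries

lemma constantCoeff_expI : constantCoeff (rescale Complex.I (exp ℂ)) = 1 := by
  rw [← coeff_zero_eq_constantCoeff_apply, coeff_rescale]
  simp

lemma constantCoeff_expI_add_one_ne_zero :
    constantCoeff (rescale Complex.I (exp ℂ) + 1) ≠ 0 := by
  rw [map_add, constantCoeff_expI, map_one]
  norm_num

lemma mul_expI_add_one :
    tanHalf * (rescale Complex.I (exp ℂ) + 1) =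
      C (-Complex.I) * (rescale Complex.I (exp ℂ) - 1) := by
  rw [tanHalf, mul_assoc, PowerSeries.inv_mul_cancel _ constantCoeff_expI_add_one_ne_zero, mul_one]

lemma derivative_expI :
    d⁄dX ℂ (rescale Complex.I (exp ℂ)) = C Complex.I * rescale Complex.I (exp ℂ) := by
  ext n
  rw [coeff_derivative, coeff_C_mul, coeff_rescale, coeff_rescale, coeff_exp, coeff_exp,
    Nat.factorial_succ]
  have h1 : ((n : ℂ) + 1) ≠ 0 := by exact_mod_cast n.succ_ne_zero
  have h2 : (n.factorial : ℂ) ≠ 0 := by exact_mod_cast n.factorial_ne_zero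
  simp only [one_div, map_inv₀, map_natCast]
  push_cast
  field_simp
  ring

/-- The Riccati equation of `tan (z / 2)`. -/
lemma two_mul_derivative : 2 * d⁄dX ℂ tanHalf = 1 + tanHalf * tanHalf := by
  have hT := mul_expI_add_one
  have hd := congrArg (d⁄dX ℂ) hT
  simp only [Derivation.leibniz, map_add, map_sub, derivative_expI, smul_eq_mul,
    Derivation.map_one_eq_zero, derivative_C] at hd
  have hD : (rescale Complex.I (exp ℂ) + 1) ≠ 0 := fun h =>
    constantCoeff_expI_add_one_ne_zero (by rw [h, map_zero])
  have hI : (C Complex.I : PowerSeries ℂ) * C Complex.I = -1 := by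
    rw [← map_mul, Complex.I_mul_I, map_neg, map_one]
  rw [map_neg] at hT hd
  generalize rescale Complex.I (exp ℂ) = E at *
  generalize (C Complex.I : PowerSeries ℂ) = i at *
  generalize d⁄dX ℂ tanHalf = T' at *
  generalize tanHalf = T at *
  apply mul_right_cancel₀ (mul_ne_zero hD hD)
  grind

lemma coeff_zero : coeff 0 tanHalf = 0 := by
  simp [tanHalf, constantCoeff_expI]

lemma coeff_succ (n : ℕ) :
    2 * (coeff (n + 1) tanHalf * (n + 1)) = coeff n (1 + tanHalf * tanHalf) := by
  rw [← two_mul_derivative, ← coeff_derivative, two_mul, two_mul, map_add]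

open scoped ComplexOrder in
lemma coeff_nonneg (n : ℕ) : 0 ≤ coeff n tanHalf := by
  induction n using Nat.strong_induction_on with
  | _ n ih =>
    cases n with
    | zero => rw [coeff_zero]
    | succ n =>
      have h : coeff (n + 1) tanHalf =
          coeff n (1 + tanHalf * tanHalf) * ((2 * (n + 1) : ℝ)⁻¹ : ℝ) := by
        have h1 : ((n : ℂ) + 1) ≠ 0 := by exact_mod_cast n.succ_ne_zero
        rw [← coeff_succ]
        push_cast
        field_simp
      rw [h]
      refine mul_nonneg ?_ (Complex.zero_le_real.mpr (by positivity))
      rw [map_add, coeff_mul, coeff_one]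
      refine add_nonneg (by split_ifs <;> simp) (Finset.sum_nonneg fun p hp => ?_)
      rw [Finset.HasAntidiagonal.mem_antidiagonal] at hp
      exact mul_nonneg (ih _ (by omega)) (ih _ (by omega))

end tanHalf

section CanonicalCommutation

variable {A : Type*} [Ring A] [Algebra ℂ A] {X P : A}

lemma mul_pow_of_canonical (hXP : X * P - P * X = algebraMap ℂ A Complex.I) (n : ℕ) :
    X * P ^ n = P ^ n * X + (Complex.I * n) • P ^ (n - 1) := by
  have hXP' : X * P = P * X + Complex.I • (1 : A) := by
    rw [← Algebra.algebraMap_eq_smul_one, ← hXP]; abel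
  induction n with
  | zero => simp
  | succ n ih =>
    rw [pow_succ, ← mul_assoc, ih, add_mul, mul_assoc, hXP', smul_mul_assoc]
    rcases n with _ | n
    · simp
    · rw [Nat.add_sub_cancel, ← pow_succ, mul_add, mul_smul_comm, mul_one, ← mul_assoc, add_assoc,
        ← add_smul]
      push_cast
      congr 2
      ring

/-- Moving powers of `P` to the left of powers of `X`. -/
lemma pow_mul_pow_of_canonical (hXP : X * P - P * X = algebraMap ℂ A Complex.I) (s r : ℕ) :
    X ^ s * P ^ r = ∑ k ∈ Finset.range (s + 1),
      (Complex.I ^ k * s.choose k * r.descFactorial k) • (P ^ (r - k) * X ^ (s - k)) := by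
  induction s with
  | zero => simp
  | succ s ih =>
    have hstep : ∀ k ∈ Finset.range (s + 1),
        X * ((Complex.I ^ k * s.choose k * r.descFactorial k) • (P ^ (r - k) * X ^ (s - k))) =
        (Complex.I ^ k * s.choose k * r.descFactorial k) • (P ^ (r - k) * X ^ (s + 1 - k)) +
        (Complex.I ^ (k + 1) * s.choose k * r.descFactorial (k + 1)) •
          (P ^ (r - (k + 1)) * X ^ (s + 1 - (k + 1))) := by
      intro k hk
      have hk' : s + 1 - k = (s - k) + 1 := by rw [Finset.mem_range] at hk; omega
      rw [mul_smul_comm, ← mul_assoc, mul_pow_of_canonical hXP, add_mul, smul_add,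
        mul_assoc (P ^ _) X, ← pow_succ', ← hk', smul_mul_assoc, smul_smul, Nat.sub_sub, Nat.add_sub_add_right,
        Nat.descFactorial_succ]
      congr 2
      push_cast
      ring
    rw [pow_succ', mul_assoc, ih, Finset.mul_sum, Finset.sum_congr rfl hstep,
      Finset.sum_add_distrib, Finset.sum_range_succ' _ (s + 1)]
    have hext : ∑ k ∈ Finset.range (s + 1),
        (Complex.I ^ k * s.choose k * r.descFactorial k) • (P ^ (r - k) * X ^ (s + 1 - k)) =
        ∑ k ∈ Finset.range (s + 2),
        (Complex.I ^ k * s.choose k * r.descFactorial k) • (P ^ (r - k) * X ^ (s + 1 - k)) := by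
      rw [Finset.sum_range_succ _ (s + 1)]
      simp
    rw [hext, Finset.sum_range_succ' _ (s + 1), add_right_comm, ← Finset.sum_add_distrib]
    congr 1
    · refine Finset.sum_congr rfl fun k _ => ?_
      rw [← add_smul, Nat.choose_succ_succ]
      congr 1
      push_cast
      ring
    · simp

lemma Nat.descFactorial_mul_descFactorial_sub (n j k : ℕ) :
    n.descFactorial j * (n - j).descFactorial k = n.descFactorial (j + k) := by
  induction k with
  | zero => simp
  | succ k ih =>
    rw [Nat.descFactorial_succ, ← add_assoc, Nat.descFactorial_succ, ← ih, Nat.sub_sub]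
    ring

/-- Letting a power series act by shifts on a finite sequence is compatible with products. -/
lemma PowerSeries.sum_coeff_mul_smul {M : Type*} [AddCommGroup M] [Module ℂ M]
    (f g : PowerSeries ℂ) (v : ℕ → M) (N : ℕ) :
    ∑ n ∈ Finset.range N, coeff n (f * g) • v n =
      ∑ j ∈ Finset.range N, coeff j f • ∑ k ∈ Finset.range (N - j), coeff k g • v (j + k) := by
  simp only [Finset.smul_sum, coeff_mul, Finset.sum_smul]
  rw [Finset.sum_sigma', Finset.sum_sigma']
  refine Finset.sum_bij' (fun x _ => ⟨x.2.1, x.2.2⟩) (fun y _ => ⟨y.1 + y.2, (y.1, y.2)⟩)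
    ?_ ?_ ?_ ?_ ?_
  · rintro ⟨n, j, k⟩ h
    simp at h ⊢
    omega
  · rintro ⟨j, k⟩ h
    simp at h ⊢
    omega
  · rintro ⟨n, j, k⟩ h
    simp at h ⊢
    exact h.2
  · rintro ⟨j, k⟩ h
    rfl
  · rintro ⟨n, j, k⟩ h
    simp at h
    simp [h.2, mul_smul]

open PowerSeries in
lemma sum_coeff_expI_smul_of_canonical (hXP : X * P - P * X = algebraMap ℂ A Complex.I)
    {s j : ℕ} (r : ℕ) (hj : j ≤ s) :
    ∑ k ∈ Finset.range (s + 1 - j), coeff k (rescale Complex.I (exp ℂ)) •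
      ((s.descFactorial (j + k) * r.descFactorial (j + k) : ℂ) •
        (P ^ (r - (j + k)) * X ^ (s - (j + k)))) =
      (s.descFactorial j * r.descFactorial j : ℂ) • (X ^ (s - j) * P ^ (r - j)) := by
  rw [pow_mul_pow_of_canonical hXP, Finset.smul_sum, Nat.sub_add_comm hj]
  refine Finset.sum_congr rfl fun k _ => ?_
  rw [smul_smul, smul_smul, Nat.sub_sub, Nat.sub_sub, coeff_rescale, coeff_exp,
    ← Nat.descFactorial_mul_descFactorial_sub s, ← Nat.descFactorial_mul_descFactorial_sub r,
    Nat.descFactorial_eq_factorial_mul_choose (s - j)]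
  congr 1
  have h2 : (k.factorial : ℂ) ≠ 0 := by exact_mod_cast k.factorial_ne_zero
  simp only [one_div, map_inv₀, map_natCast]
  push_cast
  field_simp

open PowerSeries in
lemma commutator_eq_sum_tanHalf (hXP : X * P - P * X = algebraMap ℂ A Complex.I) (s r : ℕ) :
    X ^ s * P ^ r - P ^ r * X ^ s = Complex.I • ∑ j ∈ Finset.range (s + 1),
      (coeff j tanHalf * (s.descFactorial j * r.descFactorial j)) •
        (X ^ (s - j) * P ^ (r - j) + P ^ (r - j) * X ^ (s - j)) := by
  set v : ℕ → A := fun n =>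
    (s.descFactorial n * r.descFactorial n : ℂ) • (P ^ (r - n) * X ^ (s - n)) with hv
  have hone : ∀ N, 0 < N → ∀ j, ∑ k ∈ Finset.range N, coeff k (1 : PowerSeries ℂ) • v (j + k) =
      v j := by
    intro N hN j
    rw [Finset.sum_eq_single_of_mem 0 (Finset.mem_range.mpr hN)]
    · simp
    · intro k _ hk
      simp [coeff_one, hk]
  have hexp : ∀ j ≤ s, ∑ k ∈ Finset.range (s + 1 - j),
      coeff k (rescale Complex.I (exp ℂ)) • v (j + k) =
      (s.descFactorial j * r.descFactorial j : ℂ) • (X ^ (s - j) * P ^ (r - j)) :=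
    fun j hj => sum_coeff_expI_smul_of_canonical hXP r hj
  have key := sum_coeff_mul_smul tanHalf (rescale Complex.I (exp ℂ) + 1) v (s + 1)
  have hright : ∀ j ∈ Finset.range (s + 1), coeff j tanHalf • ∑ k ∈ Finset.range (s + 1 - j),
      coeff k (rescale Complex.I (exp ℂ) + 1) • v (j + k) =
      (coeff j tanHalf * (s.descFactorial j * r.descFactorial j)) •
        (X ^ (s - j) * P ^ (r - j) + P ^ (r - j) * X ^ (s - j)) := by
    intro j hj
    rw [Finset.mem_range] at hj
    simp only [map_add, add_smul, Finset.sum_add_distrib]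
    rw [hexp j (by omega), hone _ (by omega), ← smul_add, smul_smul]
  have h0 := hexp 0 (Nat.zero_le s)
  have h1 := hone (s + 1) s.succ_pos 0
  simp only [zero_add, Nat.sub_zero, Nat.descFactorial_zero, Nat.cast_one, mul_one, one_smul]
    at h0 h1
  rw [Finset.sum_congr rfl hright, tanHalf.mul_expI_add_one] at key
  simp only [coeff_C_mul, map_sub, mul_smul, sub_smul, ← Finset.smul_sum,
    Finset.sum_sub_distrib] at key
  rw [h0, h1] at key
  simp only [mul_smul]
  rw [← key, smul_smul]
  simp [hv]

end CanonicalCommutation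

/-- The commutator `[X^s, P^r]` of powers of canonical operators with `[X, P] = i` is `i` times
a nonnegative real combination of anticommutators `{X^m, P^n}` with `m < s`, `n < r`. -/
theorem commutator_as_anticommutators (A : Type*) [Ring A] [Algebra ℂ A] (X P : A)
    (hXP : X * P - P * X = algebraMap ℂ A Complex.I)
    (s r : ℕ) (hs : 1 ≤ s) (hr : 1 ≤ r) :
    ∃ α : ℕ → ℕ → ℝ, (∀ m n, 0 ≤ α m n) ∧
      X ^ s * P ^ r - P ^ r * X ^ s =
        Complex.I •
          ∑ m ∈ Finset.range s, ∑ n ∈ Finset.range r,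
            ((α m n : ℂ)) • (X ^ m * P ^ n + P ^ n * X ^ m) := by
  have hre : ∀ j, (((PowerSeries.coeff j tanHalf).re : ℝ) : ℂ) = PowerSeries.coeff j tanHalf :=
    fun j => (Complex.eq_re_of_ofReal_le (r := 0) (tanHalf.coeff_nonneg j)).symm
  refine ⟨fun m n => if s - m = r - n then (PowerSeries.coeff (s - m) tanHalf).re *
    (s.descFactorial (s - m) * r.descFactorial (s - m)) else 0, fun m n => ?_, ?_⟩
  · have h := (Complex.nonneg_iff.mp (tanHalf.coeff_nonneg (s - m))).1
    dsimp only
    split_ifs <;> positivity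
  · rw [commutator_eq_sum_tanHalf hXP, Finset.sum_range_succ', tanHalf.coeff_zero, zero_mul,
      zero_smul, add_zero, ← Finset.sum_range_reflect]
    congr 1
    refine Finset.sum_congr rfl fun m hm => ?_
    rw [Finset.mem_range] at hm
    have hj : s - 1 - m + 1 = s - m := by omega
    have hm' : s - (s - m) = m := by omega
    rw [hj, hm']
    beta_reduce
    by_cases hle : s - m ≤ r
    · rw [Finset.sum_eq_single_of_mem (r - (s - m)) (Finset.mem_range.mpr (by omega))]
      · rw [if_pos (by omega)]
        push_cast
        rw [hre]
      · intro n hn hne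
        rw [Finset.mem_range] at hn
        rw [if_neg (by omega), Complex.ofReal_zero, zero_smul]
    · rw [Nat.descFactorial_eq_zero_iff_lt.mpr (not_le.mp hle)]
      simp
end

section
/- For all a, u, v ∈ ℂ with |a| < 1, the function z ↦ exp(−|z|² + u·z + v·(conj z) − (a/2)·z² − ((conj a)/2)·(conj z)²) is integrable over ℂ, and (1/π) ∫_ℂ exp(−|z|² + u z + v (conj z) − (a/2) z² − ((conj a)/2) (conj z)²) dA(z) = (1 − |a|²)^{−1/2} · exp((u·v − ((conj a)/2)·u² − (a/2)·v²)/(1 − |a|²)), where (1 − |a|²)^{−1/2} is the positive real square root. -/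
open MeasureTheory

/-- In the coordinates `z = x + iy`, a Gaussian on `ℂ` with real squeezing parameter `r`
is a product of one-dimensional Gaussians. -/
lemma cexp_realSqueezing_eq_mul (r : ℝ) (u v : ℂ) (p : ℝ × ℝ) :
    Complex.exp (-(‖Complex.measurableEquivRealProd.symm p‖ ^ 2 : ℝ) +
        u * Complex.measurableEquivRealProd.symm p +
        v * starRingEnd ℂ (Complex.measurableEquivRealProd.symm p) -
        (r / 2) * Complex.measurableEquivRealProd.symm p ^ 2 -
        (r / 2) * starRingEnd ℂ (Complex.measurableEquivRealProd.symm p) ^ 2) =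
      Complex.exp (-((1 + r : ℝ) : ℂ) * p.1 ^ 2 + (u + v) * p.1 + 0) *
        Complex.exp (-((1 - r : ℝ) : ℂ) * p.2 ^ 2 + Complex.I * (u - v) * p.2 + 0) := by
  rw [← Complex.exp_add, Complex.ofReal_pow, ← Complex.mul_conj',
    Complex.measurableEquivRealProd_symm_apply, Complex.mk_eq_add_mul_I]
  congr 1
  simp only [map_add, map_mul, Complex.conj_ofReal, Complex.conj_I]
  push_cast
  linear_combination (p.2 ^ 2 * (1 - r) : ℂ) * Complex.I_sq

lemma integrable_cexp_realSqueezing {r : ℝ} (hr : |r| < 1) (u v : ℂ) :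
    Integrable (fun z : ℂ =>
      Complex.exp (-(‖z‖ ^ 2 : ℝ) + u * z + v * starRingEnd ℂ z -
        (r / 2) * z ^ 2 - (r / 2) * starRingEnd ℂ z ^ 2)) := by
  obtain ⟨h₁, h₂⟩ := abs_lt.mp hr
  rw [← Complex.volume_preserving_equiv_real_prod.symm.integrable_comp_emb
    Complex.measurableEquivRealProd.symm.measurableEmbedding]
  simp only [Function.comp_def, cexp_realSqueezing_eq_mul]
  exact Integrable.mul_prod
    (integrable_cexp_quadratic (by rw [Complex.ofReal_re]; linarith) _ _)
    (integrable_cexp_quadratic (by rw [Complex.ofReal_re]; linarith) _ _)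

lemma integral_cexp_realSqueezing {r : ℝ} (hr : |r| < 1) (u v : ℂ) :
    ∫ z : ℂ, Complex.exp (-(‖z‖ ^ 2 : ℝ) + u * z + v * starRingEnd ℂ z -
        (r / 2) * z ^ 2 - (r / 2) * starRingEnd ℂ z ^ 2) =
      ((Real.pi / Real.sqrt (1 - r ^ 2) : ℝ) : ℂ) *
        Complex.exp ((u * v - (r / 2) * u ^ 2 - (r / 2) * v ^ 2) / ((1 - r ^ 2 : ℝ) : ℂ)) := by
  obtain ⟨h₁, h₂⟩ := abs_lt.mp hr
  have hp : 0 < 1 + r := by linarith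
  have hm : 0 < 1 - r := by linarith
  have gaussian_const {s : ℝ} (hs : 0 < s) :
      ((Real.pi : ℂ) / - -(s : ℂ)) ^ (1 / 2 : ℂ) = (Real.sqrt (Real.pi / s) : ℂ) := by
    rw [neg_neg, Real.sqrt_eq_rpow, Complex.ofReal_cpow (by positivity)]
    push_cast
    rfl
  have hconst : Real.sqrt (Real.pi / (1 + r)) * Real.sqrt (Real.pi / (1 - r)) =
      Real.pi / Real.sqrt (1 - r ^ 2) := by
    rw [← Real.sqrt_mul (by positivity), div_mul_div_comm, Real.sqrt_div (by positivity),
      Real.sqrt_mul_self Real.pi_pos.le]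
    ring_nf
  have hpc : (1 + r : ℂ) ≠ 0 := by exact_mod_cast hp.ne'
  have hmc : (1 - r : ℂ) ≠ 0 := by exact_mod_cast hm.ne'
  rw [← Complex.volume_preserving_equiv_real_prod.symm.integral_comp
    Complex.measurableEquivRealProd.symm.measurableEmbedding]
  simp only [cexp_realSqueezing_eq_mul]
  rw [Measure.volume_eq_prod,
    integral_prod_mul
      (fun x : ℝ => Complex.exp (-((1 + r : ℝ) : ℂ) * x ^ 2 + (u + v) * x + 0))
      (fun y : ℝ => Complex.exp (-((1 - r : ℝ) : ℂ) * y ^ 2 + Complex.I * (u - v) * y + 0)),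
    integral_cexp_quadratic (by rw [Complex.neg_re, Complex.ofReal_re]; linarith),
    integral_cexp_quadratic (by rw [Complex.neg_re, Complex.ofReal_re]; linarith),
    gaussian_const hp, gaussian_const hm, mul_mul_mul_comm, ← Complex.exp_add, ← hconst,
    Complex.ofReal_mul]
  congr 2
  have hsq : ((1 - r ^ 2 : ℝ) : ℂ) = (1 + r) * (1 - r) := by push_cast; ring
  rw [hsq, mul_pow, Complex.I_sq]
  push_cast
  field_simp
  ring

/-- Every complex number becomes its modulus after multiplication by the square of a phase. -/
lemma exists_circle_mul_sq_eq_norm (a : ℂ) : ∃ c : Circle, a * (c : ℂ) ^ 2 = ‖a‖ := by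
  refine ⟨Circle.exp (-(a.arg / 2)), ?_⟩
  nth_rw 1 [← Complex.norm_mul_exp_arg_mul_I a]
  rw [Circle.coe_exp, ← Complex.exp_nat_mul, mul_assoc, ← Complex.exp_add]
  push_cast
  ring_nf
  simp

/-- Single-mode Gaussian generating-function integral: for `|a| < 1` and `u, v ∈ ℂ`,
`(1/π) ∫_ℂ exp(-|z|² + uz + v z̄ - (a/2)z² - (ā/2)z̄²) dA(z)
  = (1-|a|²)^{-1/2} exp((uv - (ā/2)u² - (a/2)v²)/(1-|a|²))`. -/
theorem gaussian_generating_integral (a u v : ℂ) (ha : ‖a‖ < 1) :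
    Integrable (fun z : ℂ =>
        Complex.exp (-(‖z‖ ^ 2 : ℝ) + u * z + v * starRingEnd ℂ z -
          (a / 2) * z ^ 2 - (starRingEnd ℂ a / 2) * (starRingEnd ℂ z) ^ 2)) ∧
    (1 / (Real.pi : ℂ)) *
        ∫ z : ℂ,
          Complex.exp (-(‖z‖ ^ 2 : ℝ) + u * z + v * starRingEnd ℂ z -
            (a / 2) * z ^ 2 - (starRingEnd ℂ a / 2) * (starRingEnd ℂ z) ^ 2) =
      ((1 / Real.sqrt (1 - ‖a‖ ^ 2) : ℝ) : ℂ) *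
        Complex.exp ((u * v - (starRingEnd ℂ a / 2) * u ^ 2 - (a / 2) * v ^ 2) /
          ((1 - ‖a‖ ^ 2 : ℝ) : ℂ)) := by
  obtain ⟨c, hc⟩ := exists_circle_mul_sq_eq_norm a
  have hr : |‖a‖| < 1 := by rwa [abs_norm]
  have hc' : starRingEnd ℂ a * starRingEnd ℂ (c : ℂ) ^ 2 = ‖a‖ := by
    rw [← map_pow, ← map_mul, hc, Complex.conj_ofReal]
  have hcc : (c : ℂ) * starRingEnd ℂ (c : ℂ) = 1 := by
    rw [Complex.mul_conj', Circle.norm_coe]; norm_num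
  have hrot : MeasurePreserving (rotation c) := (rotation c).measurePreserving
  have hemb : MeasurableEmbedding (rotation c) :=
    (rotation c).toHomeomorph.measurableEmbedding
  have hcomp (z : ℂ) :
      Complex.exp (-(‖rotation c z‖ ^ 2 : ℝ) + u * rotation c z +
          v * starRingEnd ℂ (rotation c z) - (a / 2) * rotation c z ^ 2 -
          (starRingEnd ℂ a / 2) * (starRingEnd ℂ (rotation c z)) ^ 2) =
        Complex.exp (-(‖z‖ ^ 2 : ℝ) + (u * c) * z +
          (v * starRingEnd ℂ (c : ℂ)) * starRingEnd ℂ z -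
          ((‖a‖ : ℝ) / 2) * z ^ 2 - ((‖a‖ : ℝ) / 2) * starRingEnd ℂ z ^ 2) := by
    rw [LinearIsometryEquiv.norm_map, rotation_apply, map_mul]
    congr 1
    linear_combination (-z ^ 2 / 2) * hc - (starRingEnd ℂ z ^ 2 / 2) * hc'
  constructor
  · rw [← hrot.integrable_comp_emb hemb]
    simp only [Function.comp_def, hcomp]
    exact integrable_cexp_realSqueezing hr _ _
  · rw [← hrot.integral_comp hemb]
    simp only [hcomp]
    rw [integral_cexp_realSqueezing hr, ← mul_assoc]
    congr 1
    · have := Complex.ofReal_ne_zero.mpr Real.pi_ne_zero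
      push_cast
      field_simp
    · congr 2
      linear_combination (u * v - starRingEnd ℂ a / 2 * u ^ 2 * (1 + c * starRingEnd ℂ (c : ℂ)) -
          a / 2 * v ^ 2 * (1 + c * starRingEnd ℂ (c : ℂ))) * hcc +
        (c ^ 2 * u ^ 2 / 2) * hc' + (starRingEnd ℂ (c : ℂ) ^ 2 * v ^ 2 / 2) * hc
end

section
/- For every integer r ≥ 1, let M be the (r+1)×(r+1) real symmetric matrix with entries M_{n,n} = n + 1/2 for 0 ≤ n ≤ r, M_{n,n+2} = M_{n+2,n} = √((n+1)(n+2))/2 for 0 ≤ n ≤ r−2, and all other entries zero. Then M − (1/(16r))·I is positive semidefinite; equivalently, for every x ∈ ℝ^{r+1}, xᵀ M x ≥ (1/(16r))·‖x‖². -/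
open Matrix

/-- The incidence sum of a partial function on a finite type is at most the full sum. -/
lemma sum_sum_ite_le_sum {ι : Type*} [Fintype ι] (p : ι → ι → Prop) [∀ i, DecidablePred (p i)]
    (hp : ∀ i j k, p i j → p i k → j = k) (c : ι → ℝ) (hc : ∀ i, 0 ≤ c i) :
    ∑ i, ∑ j, (if p i j then c i else 0) ≤ ∑ i, c i := by
  refine Finset.sum_le_sum fun i _ => ?_
  rw [← Finset.sum_filter, Finset.sum_const, nsmul_eq_mul]
  have hcard : (Finset.univ.filter (p i)).card ≤ 1 :=
    Finset.card_le_one.2 fun j hj k hk => hp i j k (by simpa using hj) (by simpa using hk)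
  exact mul_le_of_le_one_left (hc i) (by exact_mod_cast hcard)

/-- Weighted arithmetic-geometric mean inequality for a coupling `√(ab) / 2`. -/
lemma neg_le_mul_sqrt_mul {a b q : ℝ} (ha : 0 ≤ a) (hb : 0 ≤ b) (hq : 0 < q) (x y : ℝ) :
    -(q * a / 4 * x ^ 2 + b / (4 * q) * y ^ 2) ≤ x * (√(a * b) / 2) * y := by
  rw [Real.sqrt_mul ha]
  have h : x * (√a * √b / 2) * y + (q * a / 4 * x ^ 2 + b / (4 * q) * y ^ 2)
      = (q * √a * x + √b * y) ^ 2 / (4 * q) := by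
    have h1 := Real.sq_sqrt ha
    have h2 := Real.sq_sqrt hb
    field_simp
    linear_combination (-2 * q ^ 2 * x ^ 2) * h1 - 2 * y ^ 2 * h2
  have : 0 ≤ (q * √a * x + √b * y) ^ 2 / (4 * q) := by positivity
  linarith

/-- The diagonal dominance margin with weight `q = 1 - 1 / (4 r)`. -/
lemma diagonal_margin {r n : ℝ} (hr : 1 ≤ r) (hn : n ≤ r) :
    1 / (16 * r) ≤ n + 1 / 2 - 2 * ((1 - 1 / (4 * r)) * (n + 1) / 4)
      - 2 * (n / (4 * (1 - 1 / (4 * r)))) := by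
  have h0 : 0 < r := by linarith
  have h1 : 0 < 4 * r - 1 := by linarith
  have hq : 1 - 1 / (4 * r) = (4 * r - 1) / (4 * r) := by field_simp
  have h : n + 1 / 2 - 2 * ((1 - 1 / (4 * r)) * (n + 1) / 4)
      - 2 * (n / (4 * (1 - 1 / (4 * r)))) - 1 / (16 * r)
      = (4 * r - 1 - 2 * n) / (16 * r * (4 * r - 1)) := by
    rw [hq]
    field_simp
    ring
  have : 0 ≤ (4 * r - 1 - 2 * n) / (16 * r * (4 * r - 1)) :=
    div_nonneg (by linarith) (by positivity)
  linarith

theorem fock_truncated_Xsq_lower_bound (r : ℕ) (hr : 1 ≤ r)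
    (M : Matrix (Fin (r + 1)) (Fin (r + 1)) ℝ)
    (hM : ∀ i j : Fin (r + 1), M i j =
      if (i : ℕ) = (j : ℕ) then ((i : ℕ) : ℝ) + 1 / 2
      else if (i : ℕ) + 2 = (j : ℕ) then
        Real.sqrt ((((i : ℕ) : ℝ) + 1) * (((i : ℕ) : ℝ) + 2)) / 2
      else if (j : ℕ) + 2 = (i : ℕ) then
        Real.sqrt ((((j : ℕ) : ℝ) + 1) * (((j : ℕ) : ℝ) + 2)) / 2
      else 0) :
    (M - (1 / (16 * r : ℝ)) • (1 : Matrix (Fin (r + 1)) (Fin (r + 1)) ℝ)).PosSemidef ∧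
    ∀ x : Fin (r + 1) → ℝ, (1 / (16 * r : ℝ)) * ∑ i, x i ^ 2 ≤ x ⬝ᵥ M.mulVec x := by
  have hr' : (1 : ℝ) ≤ r := by exact_mod_cast hr
  have hbound : ∀ x : Fin (r + 1) → ℝ,
      (1 / (16 * r : ℝ)) * ∑ i, x i ^ 2 ≤ x ⬝ᵥ M.mulVec x := by
    intro x
    obtain ⟨q, hq⟩ : ∃ q : ℝ, q = 1 - 1 / (4 * r) := ⟨_, rfl⟩
    have hq0 : 0 < q := by
      have : 1 / (4 * (r : ℝ)) < 1 := by
        rw [div_lt_one (by positivity)]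
        linarith
      linarith
    let A : Fin (r + 1) → ℝ := fun i => q * ((i : ℕ) + 1 : ℝ) / 4 * x i ^ 2
    let B : Fin (r + 1) → ℝ := fun i => ((i : ℕ) : ℝ) / (4 * q) * x i ^ 2
    have hA : ∀ i, 0 ≤ A i := fun i => by positivity
    have hB : ∀ i, 0 ≤ B i := fun i => by positivity
    let up : Fin (r + 1) → Fin (r + 1) → Prop := fun i j => (i : ℕ) + 2 = j
    let down : Fin (r + 1) → Fin (r + 1) → Prop := fun i j => (j : ℕ) + 2 = i
    have hup : ∀ i j k, up i j → up i k → j = k := fun i j k h1 h2 => by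
      simp only [up] at h1 h2; omega
    have hdown : ∀ i j k, down i j → down i k → j = k := fun i j k h1 h2 => by
      simp only [down] at h1 h2; omega
    have hupA := sum_sum_ite_le_sum up hup A hA
    have hupB := sum_sum_ite_le_sum down hdown B hB
    have hentry : ∀ i j : Fin (r + 1), (if i = j then ((i : ℕ) + 1 / 2 : ℝ) * x i ^ 2 else 0)
        - (if up i j then A i else 0) - (if down j i then B j else 0)
        - (if up j i then A j else 0) - (if down i j then B i else 0)
        ≤ x i * M i j * x j := by
      intro i j
      have hAB : ∀ i j, up i j →
          -(A i + B j) ≤ x i * (√((((i : ℕ) : ℝ) + 1) * (((i : ℕ) : ℝ) + 2)) / 2) * x j := by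
        intro i j h
        have h2 : ((j : ℕ) : ℝ) = (i : ℕ) + 2 := by
          simp only [up] at h
          exact_mod_cast h.symm
        simp only [A, B, h2]
        exact neg_le_mul_sqrt_mul (by positivity) (by positivity) hq0 _ _
      rw [hM]
      by_cases h1 : i = j
      · subst h1
        simp [up, down]
        apply le_of_eq
        ring
      · have h1' : (i : ℕ) ≠ j := fun h => h1 (Fin.ext h)
        by_cases h2 : (i : ℕ) + 2 = j
        · have h3 : ¬ ((j : ℕ) + 2 = i) := by omega
          have := hAB i j h2
          simp only [up, down, h1, h1', h2, h3, if_true, if_false]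
          linarith
        · by_cases h3 : (j : ℕ) + 2 = i
          · have := hAB j i h3
            simp only [up, down, h1, h1', h2, h3, if_true, if_false]
            linarith
          · simp [up, down, h1, h1', h2, h3]
    have hsum := Finset.sum_le_sum fun i (_ : i ∈ Finset.univ) =>
      Finset.sum_le_sum fun j (_ : j ∈ Finset.univ) => hentry i j
    simp only [Finset.sum_sub_distrib, Finset.sum_ite_eq, Finset.mem_univ, if_true] at hsum
    rw [Finset.sum_comm (f := fun i j => if up j i then A j else 0),
      Finset.sum_comm (f := fun i j => if down j i then B j else 0)] at hsum
    have hdot : x ⬝ᵥ M.mulVec x = ∑ i, ∑ j, x i * M i j * x j := by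
      simp only [dotProduct, mulVec, Finset.mul_sum, mul_assoc]
    have hdiag : (1 / (16 * r : ℝ)) * ∑ i, x i ^ 2
        ≤ ∑ i : Fin (r + 1), (((i : ℕ) + 1 / 2 : ℝ) * x i ^ 2 - 2 * A i - 2 * B i) := by
      rw [Finset.mul_sum]
      refine Finset.sum_le_sum fun i _ => ?_
      have hi : ((i : ℕ) : ℝ) ≤ r := by exact_mod_cast Nat.lt_succ_iff.1 i.2
      have h := mul_le_mul_of_nonneg_right (diagonal_margin hr' hi) (sq_nonneg (x i))
      rw [← hq] at h
      simp only [A, B]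
      linarith
    simp only [Finset.sum_sub_distrib, ← Finset.mul_sum] at hdiag
    rw [hdot]
    linarith
  refine ⟨.of_dotProduct_mulVec_nonneg ?_ fun x => ?_, hbound⟩
  · have hM' : M.IsHermitian := by
      ext i j
      rw [conjTranspose_apply, hM, hM, star_trivial]
      split_ifs <;> first | omega | simp_all
    exact hM'.sub (isHermitian_one.smul (IsSelfAdjoint.all _))
  · have h := hbound x
    simp only [star_trivial, sub_mulVec, smul_mulVec, one_mulVec, dotProduct_sub,
      dotProduct_smul, smul_eq_mul]
    have hx : x ⬝ᵥ x = ∑ i, x i ^ 2 := by simp only [dotProduct, sq]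
    rw [hx]
    linarith
end

section
/- Let H = ℓ²(ℕ, ℂ), let E > 0 and E* ≥ 0 be real numbers, and let Π : H → H be the orthogonal projection given by (Π f)(n) = f(n) if n < E and 0 otherwise. Let T be a natural number, let U_1, …, U_T be unitary operators on H, and let ψ_0 ∈ H with ‖ψ_0‖ = 1. Define ψ_i = U_i ψ_{i−1} and φ_0 = ψ_0, φ_i = Π (U_i (Π φ_{i−1})) for 1 ≤ i ≤ T. Assume that for every i ∈ {0, 1, …, T} the energy ∑_{n=0}^∞ n·|ψ_i(n)|² is summable and at most E*. Then ‖φ_T − ψ_T‖ ≤ 2·T·√(E*/E). -/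
theorem lp_two_hasSum_norm_sq (f : lp (fun _ : ℕ => ℂ) 2) :
    HasSum (fun n => ‖f n‖ ^ 2) (‖f‖ ^ 2) := by
  simpa using lp.hasSum_norm (p := 2) (by norm_num) f

theorem lp_two_norm_le_of_forall_norm_le {f g : lp (fun _ : ℕ => ℂ) 2}
    (h : ∀ n, ‖f n‖ ≤ ‖g n‖) : ‖f‖ ≤ ‖g‖ :=
  (sq_le_sq₀ (norm_nonneg _) (norm_nonneg _)).mp <|
    hasSum_le (fun n => pow_le_pow_left₀ (norm_nonneg _) (h n) 2)
      (lp_two_hasSum_norm_sq f) (lp_two_hasSum_norm_sq g)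

/-- Markov's inequality for the number operator: the part of `f` outside the energy cutoff `E`
has norm at most `√(Estar / E)`. -/
theorem norm_truncation_sub_le {E Estar : ℝ} (hE : 0 < E) {f g : lp (fun _ : ℕ => ℂ) 2}
    (hg : ∀ n : ℕ, g n = if (n : ℝ) < E then f n else 0)
    (hs : Summable fun n : ℕ => (n : ℝ) * ‖f n‖ ^ 2)
    (hle : ∑' n : ℕ, (n : ℝ) * ‖f n‖ ^ 2 ≤ Estar) :
    ‖g - f‖ ≤ Real.sqrt (Estar / E) := by
  refine Real.le_sqrt_of_sq_le ?_
  rw [le_div_iff₀' hE]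
  refine le_trans (hasSum_le (fun n => ?_) ((lp_two_hasSum_norm_sq (g - f)).mul_left E)
    hs.hasSum) hle
  rw [lp.coeFn_sub, Pi.sub_apply, hg n]
  split_ifs with h
  · simp only [sub_self, norm_zero, ne_eq, OfNat.ofNat_ne_zero, not_false_eq_true, zero_pow,
      mul_zero]
    positivity
  · rw [zero_sub, norm_neg]
    exact mul_le_mul_of_nonneg_right (not_lt.mp h) (sq_nonneg _)

/-- Error-propagation bound for truncated bosonic circuits on `ℓ²(ℕ, ℂ)`: if `Π` is the
coordinate projection onto indices `n < E`, `ψ_i = U_i ψ_{i-1}` is the true evolution of a unit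
vector `ψ_0` under unitaries `U_1, …, U_T`, `φ_i = Π U_i Π φ_{i-1}` (with `φ_0 = ψ_0`) is the
truncated evolution, and every `ψ_i` has number-operator energy `∑ n n·|ψ_i(n)|² ≤ E*`, then
`‖φ_T - ψ_T‖ ≤ 2 T √(E*/E)`. -/
theorem truncated_evolution_error (E Estar : ℝ) (hE : 0 < E) (hEstar : 0 ≤ Estar)
    (Pr : lp (fun _ : ℕ => ℂ) 2 →L[ℂ] lp (fun _ : ℕ => ℂ) 2)
    (hPr : ∀ f : lp (fun _ : ℕ => ℂ) 2, ∀ n : ℕ,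
      (Pr f) n = if (n : ℝ) < E then f n else 0)
    (T : ℕ)
    (U : ℕ → (lp (fun _ : ℕ => ℂ) 2 ≃ₗᵢ[ℂ] lp (fun _ : ℕ => ℂ) 2))
    (ψ φ : ℕ → lp (fun _ : ℕ => ℂ) 2)
    (hψ0 : ‖ψ 0‖ = 1) (hφ0 : φ 0 = ψ 0)
    (hψ : ∀ i < T, ψ (i + 1) = U (i + 1) (ψ i))
    (hφ : ∀ i < T, φ (i + 1) = Pr (U (i + 1) (Pr (φ i))))
    (henergy : ∀ i ≤ T, Summable (fun n : ℕ => (n : ℝ) * ‖(ψ i) n‖ ^ 2) ∧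
      ∑' n : ℕ, (n : ℝ) * ‖(ψ i) n‖ ^ 2 ≤ Estar) :
    ‖φ T - ψ T‖ ≤ 2 * T * Real.sqrt (Estar / E) := by
  have hcontr (f : lp (fun _ : ℕ => ℂ) 2) : ‖Pr f‖ ≤ ‖f‖ := by
    refine lp_two_norm_le_of_forall_norm_le fun n => ?_
    rw [hPr]
    split_ifs <;> simp
  have htail (i : ℕ) (hi : i ≤ T) : ‖Pr (ψ i) - ψ i‖ ≤ Real.sqrt (Estar / E) :=
    norm_truncation_sub_le hE (hPr (ψ i)) (henergy i hi).1 (henergy i hi).2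
  have herr (i : ℕ) (hi : i ≤ T) : ‖φ i - ψ i‖ ≤ 2 * i * Real.sqrt (Estar / E) := by
    induction i with
    | zero => simp [hφ0]
    | succ i ih =>
      have hlt : i < T := hi
      have hsplit : φ (i + 1) - ψ (i + 1) =
          Pr (U (i + 1) (Pr (φ i - ψ i))) + Pr (U (i + 1) (Pr (ψ i) - ψ i)) +
            (Pr (ψ (i + 1)) - ψ (i + 1)) := by
        rw [hφ i hlt, hψ i hlt]
        simp only [map_sub]
        abel
      have hold : ‖Pr (U (i + 1) (Pr (φ i - ψ i)))‖ ≤ ‖φ i - ψ i‖ :=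
        (hcontr _).trans (((U (i + 1)).norm_map _).le.trans (hcontr _))
      have hnew : ‖Pr (U (i + 1) (Pr (ψ i) - ψ i))‖ ≤ ‖Pr (ψ i) - ψ i‖ :=
        (hcontr _).trans ((U (i + 1)).norm_map _).le
      rw [hsplit]
      refine norm_add₃_le.trans ?_
      push_cast
      linarith [ih hlt.le, htail i hlt.le, htail (i + 1) hi]
  exact herr T le_rfl
end

section
/- Define G : ℂ × ℂ → ℂ by G(s, t) = exp(−(s² + t² + 2·i·s·t)/4). For natural numbers k and l set n = k + l and let D denote the iterated partial derivative ∂_s^k ∂_t^l G evaluated at (0, 0) (i.e. the l-fold derivative in t at 0 of the function t ↦ (k-fold derivative in s at 0 of s ↦ G(s,t))). Then: if n is odd, D = 0; and if n is even, D = i^n · (exp(i·π·n/8) / 2^{3n/4}) · ∑_{m=0}^{n/2} (−i)^m · K_{2m} · (n − 2m − 1)!! · (2m − 1)!!, where K_{2m} = ∑_{j=0}^{2m} (−1)^j · C(l, j) · C(k, 2m − j), the double factorial satisfies the convention (−1)!! = 1, and 2^{3n/4} denotes the positive real power. -/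
open Finset in
/-- A double binomial sum over a rectangle, regrouped along its antidiagonals. -/
theorem sum_choose_mul_choose_eq_sum_kravchuk {R : Type*} [CommRing R] (k l : ℕ) (F : ℕ → R) :
    ∑ j ∈ range (k + 1), ∑ i ∈ range (l + 1),
        (k.choose j : R) * ((-1) ^ i * (l.choose i : R)) * F (i + j) =
      ∑ p ∈ range (k + l + 1),
        ((∑ i ∈ range (p + 1),
          ((-1 : ℤ) ^ i * (l.choose i : ℤ) * (k.choose (p - i) : ℤ)) : ℤ) : R) * F p := by
  simp only [Int.cast_sum, sum_mul]
  rw [← sum_product', sum_sigma']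
  refine sum_of_injOn (fun x => ⟨x.2 + x.1, x.2⟩) ?_ ?_ ?_ ?_
  · rintro ⟨j, i⟩ - ⟨j', i'⟩ - h
    simp only [Sigma.mk.injEq, heq_eq_eq] at h
    ext <;> simp <;> omega
  · rintro ⟨j, i⟩ h
    simp only [coe_product, Set.mem_prod, coe_range, Set.mem_Iio] at h
    simp only [coe_sigma, Set.mem_sigma_iff, coe_range, Set.mem_Iio]
    omega
  · rintro ⟨p, i⟩ h hn
    simp only [mem_sigma, mem_range] at h
    suffices l < i ∨ k < p - i by
      rcases this with h | h <;> simp [Nat.choose_eq_zero_of_lt h]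
    by_contra! hc
    refine hn ⟨(p - i, i), ?_, ?_⟩
    · simp only [coe_product, Set.mem_prod, coe_range, Set.mem_Iio]
      omega
    · simp only [Sigma.mk.injEq, heq_eq_eq, and_true]
      omega
  · rintro ⟨j, i⟩ -
    simp only [add_tsub_cancel_left]
    push_cast
    ring

theorem iteratedDeriv_iteratedDeriv {𝕜 F : Type*} [NontriviallyNormedField 𝕜]
    [NormedAddCommGroup F] [NormedSpace 𝕜 F] (m n : ℕ) (f : 𝕜 → F) :
    iteratedDeriv m (iteratedDeriv n f) = iteratedDeriv (m + n) f := by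
  simp only [iteratedDeriv_eq_iterate, Function.iterate_add_apply]

open Finset in
open scoped ContDiff in
/-- Mixed partial derivatives at the origin of a function separated in the variables
`s - t` and `s + t`. -/
theorem iteratedDeriv_iteratedDeriv_mul_comp_sub_add {𝕜 : Type*} [NontriviallyNormedField 𝕜]
    {f g : 𝕜 → 𝕜} (hf : ContDiff 𝕜 ∞ f) (hg : ContDiff 𝕜 ∞ g) (k l : ℕ) :
    iteratedDeriv l (fun t => iteratedDeriv k (fun s => g (s - t) * f (s + t)) 0) 0 =
      ∑ p ∈ range (k + l + 1),
        ((∑ i ∈ range (p + 1),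
          ((-1 : ℤ) ^ i * (l.choose i : ℤ) * (k.choose (p - i) : ℤ)) : ℤ) : 𝕜) *
        (iteratedDeriv p g 0 * iteratedDeriv (k + l - p) f 0) := by
  have smooth {h : 𝕜 → 𝕜} (hh : ContDiff 𝕜 ∞ h) (m : ℕ) : ContDiff 𝕜 ∞ (iteratedDeriv m h) := by
    rw [iteratedDeriv_eq_iterate]
    exact hh.iterate_deriv m
  have hs (t : 𝕜) : iteratedDeriv k (fun s => g (s - t) * f (s + t)) 0 =
      ∑ j ∈ range (k + 1),
        (k.choose j : 𝕜) * (iteratedDeriv j g (-t) * iteratedDeriv (k - j) f t) := by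
    have hg' : ContDiff 𝕜 ∞ (fun s => g (s - t)) := hg.comp (contDiff_id.sub contDiff_const)
    have hf' : ContDiff 𝕜 ∞ (fun s => f (s + t)) := hf.comp (contDiff_id.add contDiff_const)
    have := iteratedDeriv_mul (n := k) (x := 0) (hg'.contDiffAt.of_le (mod_cast le_top))
      (hf'.contDiffAt.of_le (mod_cast le_top))
    rw [← Pi.mul_def, this]
    simp [iteratedDeriv_comp_sub_const, iteratedDeriv_comp_add_const, mul_assoc]
  have ht (j : ℕ) (hj : j ≤ k) :
      iteratedDeriv l (fun t => iteratedDeriv j g (-t) * iteratedDeriv (k - j) f t) 0 =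
      ∑ i ∈ range (l + 1), ((-1) ^ i * (l.choose i : 𝕜)) *
        (iteratedDeriv (i + j) g 0 * iteratedDeriv (k + l - (i + j)) f 0) := by
    have hg' : ContDiff 𝕜 ∞ (fun t => iteratedDeriv j g (-t)) := (smooth hg j).comp contDiff_neg
    have := iteratedDeriv_mul (n := l) (x := 0) (hg'.contDiffAt.of_le (mod_cast le_top))
      ((smooth hf (k - j)).contDiffAt.of_le (mod_cast le_top))
    rw [← Pi.mul_def, this]
    refine sum_congr rfl fun i hi => ?_
    have hi' : i ≤ l := by simpa [Nat.lt_succ_iff] using hi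
    rw [iteratedDeriv_comp_neg, iteratedDeriv_iteratedDeriv, iteratedDeriv_iteratedDeriv, neg_zero,
      show l - i + (k - j) = k + l - (i + j) by omega, smul_eq_mul]
    ring
  rw [← sum_choose_mul_choose_eq_sum_kravchuk k l
    (fun p => iteratedDeriv p g 0 * iteratedDeriv (k + l - p) f 0)]
  simp only [hs]
  rw [iteratedDeriv_fun_sum]
  · refine sum_congr rfl fun j hj => ?_
    rw [iteratedDeriv_const_mul_field, ht j (by simpa [Nat.lt_succ_iff] using hj), mul_sum]
    exact sum_congr rfl fun i _ => by ring
  · intro j _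
    refine ContDiffAt.of_le (n := ∞) (ContDiff.contDiffAt ?_) (mod_cast le_top)
    exact contDiff_const.mul (((smooth hg j).comp contDiff_neg).mul (smooth hf (k - j)))

open scoped ContDiff in
theorem contDiff_cexp_mul_sq (c : ℂ) : ContDiff ℂ ∞ (fun x : ℂ => Complex.exp (c * x ^ 2)) := by
  fun_prop

theorem deriv_cexp_mul_sq (c : ℂ) :
    deriv (fun x : ℂ => Complex.exp (c * x ^ 2)) =
      fun x => 2 * c * (x * Complex.exp (c * x ^ 2)) := by
  funext x
  have h : HasDerivAt (fun x : ℂ => c * x ^ 2) (c * (2 * x)) x := by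
    simpa using (hasDerivAt_pow 2 x).const_mul c
  rw [h.cexp.deriv]
  ring

theorem iteratedDeriv_cexp_mul_sq_add_two (c : ℂ) (a : ℕ) :
    iteratedDeriv (a + 2) (fun x : ℂ => Complex.exp (c * x ^ 2)) 0 =
      2 * c * (a + 1) * iteratedDeriv a (fun x : ℂ => Complex.exp (c * x ^ 2)) 0 := by
  have hm := iteratedDeriv_mul (n := a + 1) (x := (0 : ℂ)) (f := fun x : ℂ => x)
    contDiffAt_id ((contDiff_cexp_mul_sq c).contDiffAt.of_le (mod_cast le_top))
  rw [iteratedDeriv_succ', deriv_cexp_mul_sq, iteratedDeriv_const_mul_field, ← Pi.mul_def, hm,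
    Finset.sum_eq_single 1]
  · simp [iteratedDeriv_one]
    ring
  · intro i _ hi
    simp [iteratedDeriv_fun_id_zero, hi]
  · simp

theorem iteratedDeriv_cexp_mul_sq_of_odd (c : ℂ) {a : ℕ} (ha : Odd a) :
    iteratedDeriv a (fun x : ℂ => Complex.exp (c * x ^ 2)) 0 = 0 := by
  obtain ⟨m, rfl⟩ := ha
  induction m with
  | zero => simp [iteratedDeriv_one, deriv_cexp_mul_sq]
  | succ m ih =>
    rw [show 2 * (m + 1) + 1 = 2 * m + 1 + 2 by ring, iteratedDeriv_cexp_mul_sq_add_two, ih,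
      mul_zero]

theorem iteratedDeriv_cexp_mul_sq_two_mul (c : ℂ) (a : ℕ) :
    iteratedDeriv (2 * a) (fun x : ℂ => Complex.exp (c * x ^ 2)) 0 =
      (2 * c) ^ a * (Nat.doubleFactorial (2 * a - 1) : ℂ) := by
  induction a with
  | zero => simp
  | succ a ih =>
    have hf : Nat.doubleFactorial (2 * (a + 1) - 1) =
        (2 * a + 1) * Nat.doubleFactorial (2 * a - 1) := by
      cases a with
      | zero => simp
      | succ a => exact Nat.doubleFactorial_add_two (2 * a + 1)
    rw [show 2 * (a + 1) = 2 * a + 2 by ring, iteratedDeriv_cexp_mul_sq_add_two, ih,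
      show 2 * a + 2 = 2 * (a + 1) by ring, hf]
    push_cast
    ring

theorem cexp_I_mul_pi_div_four :
    Complex.exp (Complex.I * (Real.pi : ℂ) / 4) = ((Real.sqrt 2 : ℝ) : ℂ) / 2 * (1 + Complex.I) := by
  rw [show Complex.I * (Real.pi : ℂ) / 4 = ((Real.pi / 4 : ℝ) : ℂ) * Complex.I by push_cast; ring,
    Complex.exp_mul_I, ← Complex.ofReal_cos, ← Complex.ofReal_sin, Real.cos_pi_div_four,
    Real.sin_pi_div_four]
  push_cast
  ring

theorem I_pow_mul_cexp_div_two_rpow (N : ℕ) :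
    Complex.I ^ (2 * N) *
        (Complex.exp (Complex.I * (Real.pi : ℂ) * ((2 * N : ℕ) : ℂ) / 8) /
          (((2 : ℝ) ^ ((3 * ((2 * N : ℕ) : ℝ)) / 4) : ℝ) : ℂ)) =
      (-(1 + Complex.I) / 4) ^ N := by
  have hr : (2 : ℝ) ^ ((3 * ((2 * N : ℕ) : ℝ)) / 4) = (2 * Real.sqrt 2) ^ N := by
    rw [show (3 * ((2 * N : ℕ) : ℝ)) / 4 = (1 + 1 / 2) * (N : ℝ) by push_cast; ring,
      Real.rpow_mul (by norm_num), Real.rpow_natCast, Real.rpow_add (by norm_num), Real.rpow_one,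
      Real.sqrt_eq_rpow]
  have he : Complex.exp (Complex.I * (Real.pi : ℂ) * ((2 * N : ℕ) : ℂ) / 8) =
      (((Real.sqrt 2 : ℝ) : ℂ) / 2 * (1 + Complex.I)) ^ N := by
    rw [← cexp_I_mul_pi_div_four, ← Complex.exp_nat_mul]
    push_cast
    ring_nf
  have h2 : ((Real.sqrt 2 : ℝ) : ℂ) ≠ 0 := by simp
  rw [hr, he, pow_mul, Complex.I_sq, Complex.ofReal_pow, ← div_pow, ← mul_pow]
  congr 1
  push_cast
  field_simp
  ring

theorem neg_one_add_I_div_four_pow_mul {N m : ℕ} (h : m ≤ N) :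
    (-(1 + Complex.I) / 4) ^ N * (-Complex.I) ^ m =
      (-(1 - Complex.I) / 4) ^ m * (-(1 + Complex.I) / 4) ^ (N - m) := by
  have hc : -(1 - Complex.I) / 4 = -(1 + Complex.I) / 4 * -Complex.I := by
    linear_combination -(1 / 4) * Complex.I_sq
  rw [hc, mul_pow, mul_right_comm, ← pow_add, Nat.add_sub_cancel' h]


/-- Mixed vacuum moments from the characteristic function `G(s,t) = exp(-(s²+t²+2ist)/4)`:
the derivative `D = ∂_s^k ∂_t^l G (0,0)` vanishes when `n = k + l` is odd, and when `n` is even,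
`D = iⁿ (e^{iπn/8}/2^{3n/4}) ∑_{m=0}^{n/2} (-i)^m K_{2m} (n-2m-1)!! (2m-1)!!`, where
`K_{2m} = ∑_{j=0}^{2m} (-1)^j C(l,j) C(k,2m-j)`. -/
theorem vacuum_moments_via_kravchuk (k l : ℕ) :
    (Odd (k + l) →
      iteratedDeriv l
        (fun t : ℂ => iteratedDeriv k
          (fun s : ℂ => Complex.exp (-(s ^ 2 + t ^ 2 + 2 * Complex.I * s * t) / 4)) 0) 0 = 0) ∧
    (Even (k + l) →
      iteratedDeriv l
        (fun t : ℂ => iteratedDeriv k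
          (fun s : ℂ => Complex.exp (-(s ^ 2 + t ^ 2 + 2 * Complex.I * s * t) / 4)) 0) 0 =
      Complex.I ^ (k + l) *
        (Complex.exp (Complex.I * (Real.pi : ℂ) * ((k + l : ℕ) : ℂ) / 8) /
          (((2 : ℝ) ^ ((3 * ((k + l : ℕ) : ℝ)) / 4) : ℝ) : ℂ)) *
        ∑ m ∈ Finset.range ((k + l) / 2 + 1),
          (-Complex.I) ^ m *
            ((∑ j ∈ Finset.range (2 * m + 1),
                ((-1 : ℤ) ^ j * (Nat.choose l j : ℤ) * (Nat.choose k (2 * m - j) : ℤ)) : ℤ) : ℂ) *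
            ((Nat.doubleFactorial (k + l - 2 * m - 1) : ℕ) : ℂ) *
            ((Nat.doubleFactorial (2 * m - 1) : ℕ) : ℂ)) := by
  have hG : (fun t : ℂ => iteratedDeriv k
        (fun s : ℂ => Complex.exp (-(s ^ 2 + t ^ 2 + 2 * Complex.I * s * t) / 4)) 0) =
      fun t => iteratedDeriv k (fun s =>
        (fun v : ℂ => Complex.exp (-(1 - Complex.I) / 8 * v ^ 2)) (s - t) *
        (fun u : ℂ => Complex.exp (-(1 + Complex.I) / 8 * u ^ 2)) (s + t)) 0 := by
    funext t
    congr 1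
    funext s
    simp only [← Complex.exp_add]
    congr 1
    ring
  rw [hG, iteratedDeriv_iteratedDeriv_mul_comp_sub_add (contDiff_cexp_mul_sq _)
    (contDiff_cexp_mul_sq _)]
  constructor
  · intro hodd
    refine Finset.sum_eq_zero fun p hp => ?_
    rcases Nat.even_or_odd p with he | ho
    · have : Odd (k + l - p) :=
        Nat.Odd.sub_even (Nat.lt_succ_iff.mp (Finset.mem_range.mp hp)) hodd he
      rw [iteratedDeriv_cexp_mul_sq_of_odd _ this, mul_zero, mul_zero]
    · rw [iteratedDeriv_cexp_mul_sq_of_odd _ ho, zero_mul, mul_zero]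
  · intro hev
    obtain ⟨N, hN⟩ := hev.two_dvd
    rw [hN, I_pow_mul_cexp_div_two_rpow, Nat.mul_div_cancel_left N two_pos, Finset.mul_sum]
    symm
    refine Finset.sum_of_injOn (2 * ·) (fun a _ b _ h => by simpa using h) ?_ ?_ ?_
    · intro m hm
      simp only [Finset.coe_range, Set.mem_Iio] at hm ⊢
      omega
    · intro p hp hn
      have ho : Odd p := by
        by_contra he
        obtain ⟨m, rfl⟩ := (Nat.not_odd_iff_even.mp he).two_dvd
        refine hn ⟨m, ?_, rfl⟩
        simp only [Finset.mem_range] at hp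
        simp only [Finset.coe_range, Set.mem_Iio]
        omega
      rw [iteratedDeriv_cexp_mul_sq_of_odd _ ho, zero_mul, mul_zero]
    · intro m hm
      have hmN : m ≤ N := Nat.lt_succ_iff.mp (Finset.mem_range.mp hm)
      rw [← Nat.mul_sub, iteratedDeriv_cexp_mul_sq_two_mul, iteratedDeriv_cexp_mul_sq_two_mul,
        show 2 * (-(1 - Complex.I) / 8) = -(1 - Complex.I) / 4 by ring,
        show 2 * (-(1 + Complex.I) / 8) = -(1 + Complex.I) / 4 by ring]
      linear_combination
        ((∑ j ∈ Finset.range (2 * m + 1),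
          ((-1 : ℤ) ^ j * (Nat.choose l j : ℤ) * (Nat.choose k (2 * m - j) : ℤ)) : ℤ) : ℂ) *
        ((Nat.doubleFactorial (2 * (N - m) - 1) : ℕ) : ℂ) *
        ((Nat.doubleFactorial (2 * m - 1) : ℕ) : ℂ) * neg_one_add_I_div_four_pow_mul hmN
end
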